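/- There exists a positive measure R_s on 𝒵 whose Laplace transform satisfies L_{R_s}(ξ) = δ_{−s}(ξ) for all ξ ∈ 𝒬 if and only if s ∈ Ξ := ⋃_{ε ∈ {0,1}^r} Ξ(ε) (a disjoint union), where Ξ(ε) := {s ∈ ℝ^r : s_k > ½ Σ_{i<k} ε_i dim 𝒱_{ki} if ε_k = 1, and s_k = ½ Σ_{i<k} ε_i dim 𝒱_{ki} if ε_k = 0}. Moreover the support of R_s is contained in the closure of 𝒫. -/

import Mathlib

open Matrix MeasureTheory Finset
open scoped ENNReal

namespace Wishart

instance {m n α : Type*} [MeasurableSpace α] : MeasurableSpace (Matrix m n α) :=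
  inferInstanceAs (MeasurableSpace (m → n → α))

/-- Index set of an `N × N` matrix partitioned into `r + 1` blocks of sizes `n 0, …, n r`. -/
abbrev Idx (r : ℕ) (n : Fin (r + 1) → ℕ+) := Σ k : Fin (r + 1), Fin (n k)

/-- Real matrices over the partitioned index set. -/
abbrev Mat (r : ℕ) (n : Fin (r + 1) → ℕ+) := Matrix (Idx r n) (Idx r n) ℝ

variable {r : ℕ} {n : Fin (r + 1) → ℕ+}

/-- The `(l,k)` block of a partitioned matrix. -/
def blk (x : Mat r n) (l k : Fin (r + 1)) : Matrix (Fin (n l)) (Fin (n k)) ℝ :=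
  Matrix.of fun a b => x ⟨l, a⟩ ⟨k, b⟩

variable (V : ∀ l k : Fin (r + 1), Submodule ℝ (Matrix (Fin (n l)) (Fin (n k)) ℝ))

/-- Condition (V1): `A ∈ 𝒱_{lk}`, `B ∈ 𝒱_{ki}` implies `A B ∈ 𝒱_{li}` for `i < k < l`. -/
def CondV1 : Prop := ∀ i k l : Fin (r + 1), i < k → k < l →
  ∀ A ∈ V l k, ∀ B ∈ V k i, A * B ∈ V l i

/-- Condition (V2): `A ∈ 𝒱_{li}`, `B ∈ 𝒱_{ki}` implies `A Bᵀ ∈ 𝒱_{lk}` for `i < k < l`. -/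
def CondV2 : Prop := ∀ i k l : Fin (r + 1), i < k → k < l →
  ∀ A ∈ V l i, ∀ B ∈ V k i, A * Bᵀ ∈ V l k

/-- Condition (V3): `A ∈ 𝒱_{lk}` implies `A Aᵀ ∈ ℝ I`. -/
def CondV3 : Prop := ∀ k l : Fin (r + 1), k < l →
  ∀ A ∈ V l k, ∃ c : ℝ, A * Aᵀ = c • (1 : Matrix (Fin (n l)) (Fin (n l)) ℝ)

/-- The space `𝒵` of symmetric matrices with lower blocks in `𝒱_{lk}` and scalar diagonal
blocks. -/
def Zspace : Set (Mat r n) :=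
  {x | x.IsSymm ∧ (∀ k l : Fin (r + 1), k < l → blk x l k ∈ V l k) ∧
    ∀ k : Fin (r + 1), ∃ c : ℝ, ∀ a b : Fin (n k),
      x ⟨k, a⟩ ⟨k, b⟩ = if a = b then c else 0}

/-- The trace inner product `⟨x, y⟩ = tr (x y)`. -/
def tip (x y : Mat r n) : ℝ := (x * y).trace

/-- The homogeneous cone `𝒫 = 𝒵 ∩ Sym₊(N, ℝ)`. -/
def Pcone : Set (Mat r n) := {x | x ∈ Zspace V ∧ x.PosDef}

/-- The dual cone `𝒬 = {ξ ∈ 𝒵 : ⟨ξ, x⟩ > 0 for all nonzero x in the closure of 𝒫}`. -/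
def Qcone : Set (Mat r n) :=
  {ξ | ξ ∈ Zspace V ∧ ∀ x ∈ closure (Pcone V), x ≠ 0 → 0 < tip ξ x}

/-- The group `H` of block lower triangular matrices with strictly lower blocks in `𝒱_{lk}`
and positive scalar diagonal blocks. -/
def Hgrp : Set (Mat r n) :=
  {T | (∀ k l : Fin (r + 1), l < k → blk T l k = 0) ∧
    (∀ k l : Fin (r + 1), k < l → blk T l k ∈ V l k) ∧
    ∀ k : Fin (r + 1), ∃ t : ℝ, 0 < t ∧ ∀ a b : Fin (n k),
      T ⟨k, a⟩ ⟨k, b⟩ = if a = b then t else 0}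

/-- `ρ(T) x = T x Tᵀ`. -/
def rhoM (T x : Mat r n) : Mat r n := T * x * Tᵀ

/-- The diagonal scalar `t_{kk}` of a matrix with scalar diagonal blocks. -/
def tdiag (T : Mat r n) (k : Fin (r + 1)) : ℝ :=
  T ⟨k, ⟨0, (n k).2⟩⟩ ⟨k, ⟨0, (n k).2⟩⟩

/-- The one-dimensional representation `χ_s(T) = ∏_k t_{kk}^{2 s_k}`. -/
noncomputable def chi (s : Fin (r + 1) → ℝ) (T : Mat r n) : ℝ :=
  ∏ k : Fin (r + 1), tdiag T k ^ (2 * s k)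

/-- `½ Σ_{i<k} ε_i dim 𝒱_{ki}`. -/
noncomputable def xiBound (ε : Fin (r + 1) → Bool) (k : Fin (r + 1)) : ℝ :=
  (1 / 2) * ∑ i ∈ Finset.univ.filter (fun i => i < k),
    (if ε i then (Module.finrank ℝ (V k i) : ℝ) else 0)

/-- The Gindikin set `Ξ`. -/
def XiSet : Set (Fin (r + 1) → ℝ) :=
  ⋃ ε : Fin (r + 1) → Bool,
    {s | ∀ k, (ε k = true → xiBound V ε k < s k) ∧ (ε k = false → s k = xiBound V ε k)}

/-- `½ Σ_{l>k} ε_l dim 𝒱_{lk}`. -/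
noncomputable def frakBound (ε : Fin (r + 1) → Bool) (k : Fin (r + 1)) : ℝ :=
  (1 / 2) * ∑ l ∈ Finset.univ.filter (fun l => k < l),
    (if ε l then (Module.finrank ℝ (V l k) : ℝ) else 0)

/-- The Gindikin set `𝔛`. -/
def frakX : Set (Fin (r + 1) → ℝ) :=
  ⋃ ε : Fin (r + 1) → Bool,
    {s | ∀ k, (ε k = true → frakBound V ε k < s k) ∧ (ε k = false → s k = frakBound V ε k)}

/-- Laplace transform `L_μ(θ) = ∫ e^{-⟨θ,x⟩} dμ(x)` (with values in `[0,∞]`). -/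
noncomputable def laplace (μ : Measure (Mat r n)) (θ : Mat r n) : ℝ≥0∞ :=
  ∫⁻ x, ENNReal.ofReal (Real.exp (-(tip θ x))) ∂μ

/-- Real-valued Laplace transform. -/
noncomputable def laplaceR (μ : Measure (Mat r n)) (θ : Mat r n) : ℝ :=
  ∫ x, Real.exp (-(tip θ x)) ∂μ

/-- Mean of the natural-exponential-family member `P(θ,μ)`, computed entrywise:
`m_μ(θ) = L_μ(θ)⁻¹ ∫ x e^{-⟨θ,x⟩} dμ(x)`. -/
noncomputable def meanMap (μ : Measure (Mat r n)) (θ : Mat r n) : Mat r n :=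
  Matrix.of fun p q => (laplaceR μ θ)⁻¹ * ∫ x, Real.exp (-(tip θ x)) * x p q ∂μ

/-- Covariance operator of `P(θ,μ)` with mean `m`, applied to `ξ ∈ 𝒵` (entrywise):
`V ξ = ∫ ⟨ξ, x - m⟩ (x - m) dP(θ,μ)(x)`. -/
noncomputable def varOp (μ : Measure (Mat r n)) (θ m ξ : Mat r n) : Mat r n :=
  Matrix.of fun p q =>
    (laplaceR μ θ)⁻¹ * ∫ x, Real.exp (-(tip θ x)) * tip ξ (x - m) * ((x - m) p q) ∂μ

/-- Leading principal submatrix `y_{{1:k}}` consisting of the blocks with indices `≤ k`. -/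
def lead (k : Fin (r + 1)) (y : Mat r n) :
    Matrix {p : Idx r n // p.1 ≤ k} {p : Idx r n // p.1 ≤ k} ℝ :=
  Matrix.of fun p q => y p.1 q.1

/-- Zero-padding `z₀` of a matrix `z` defined on the blocks with indices `≤ k`. -/
def pad (k : Fin (r + 1)) (z : Matrix {p : Idx r n // p.1 ≤ k} {p : Idx r n // p.1 ≤ k} ℝ) :
    Mat r n :=
  Matrix.of fun p q => if h : p.1 ≤ k ∧ q.1 ≤ k then z ⟨p, h.1⟩ ⟨q, h.2⟩ else 0

/-- `J_k = (I_{N_k})₀`. -/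
def Jmat (k : Fin (r + 1)) : Mat r n := pad k 1

/-- Parameters of elements of `W_i`: the scalar `x_{ii}` and the blocks `X_{li}`. -/
abbrev Wparam (r : ℕ) (n : Fin (r + 1) → ℕ+) (i : Fin (r + 1)) :=
  ℝ × ∀ l : Fin (r + 1), Matrix (Fin (n l)) (Fin (n i)) ℝ

/-- The `N × n_i` matrix in `W_i` with `i`-th block row `x_{ii} I` and `l`-th block row
`X_{li}` for `l > i`. -/
def toW (i : Fin (r + 1)) (p : Wparam r n i) : Matrix (Idx r n) (Fin (n i)) ℝ :=
  Matrix.of fun q b =>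
    if q.1 = i then (if (q.2 : ℕ) = (b : ℕ) then p.1 else 0)
    else if i < q.1 then p.2 q.1 q.2 b else 0

/-- A parameter tuple gives an honest element of `W_i`: blocks lie in `𝒱_{li}` and vanish
for `l ≤ i`. -/
def WGood (i : Fin (r + 1)) (p : Wparam r n i) : Prop :=
  (∀ l : Fin (r + 1), i < l → p.2 l ∈ V l i) ∧ (∀ l : Fin (r + 1), ¬ i < l → p.2 l = 0)

/-- The inner product `(A|B)` on `𝒱_{lk}`, characterized by `(ABᵀ + BAᵀ)/2 = (A|B) I`. -/
noncomputable def bip (l : Fin (r + 1)) {k : Fin (r + 1)}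
    (A B : Matrix (Fin (n l)) (Fin (n k)) ℝ) : ℝ :=
  (A * Bᵀ).trace / (n l : ℝ)

open scoped Classical in
/-- The generalized power function `Δ_s` on `𝒫`, defined by `Δ_s(ρ(T) I) = χ_s(T)`. -/
noncomputable def DeltaDef (s : Fin (r + 1) → ℝ) (x : Mat r n) : ℝ :=
  if h : ∃ T, T ∈ Hgrp V ∧ x = rhoM T 1 then chi s h.choose else 0

/-- Index set for the block diagonal matrix `Φ(ξ) = diag(φ_0(ξ), …, φ_r(ξ))`,
where `φ_i(ξ)` is of size `m_i = mdc i + 1`. -/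
abbrev DIdx (r : ℕ) (mdc : Fin (r + 1) → ℕ) := Σ i : Fin (r + 1), Fin (mdc i + 1)

/-- The block diagonal matrix `Φ(ξ) = diag(φ_0(ξ), …, φ_r(ξ))`. -/
def PhiMat {mdc : Fin (r + 1) → ℕ}
    (φ : ∀ i : Fin (r + 1), Mat r n → Matrix (Fin (mdc i + 1)) (Fin (mdc i + 1)) ℝ)
    (ξ : Mat r n) : Matrix (DIdx r mdc) (DIdx r mdc) ℝ :=
  Matrix.of fun p q =>
    if h : p.1 = q.1 then φ p.1 ξ p.2 (Fin.cast (by rw [h]) q.2) else 0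

/-- `Φ(I_N)^{-1/2}`: the inverse square root of the (diagonal, positive) matrix `Φ(I_N)`. -/
noncomputable def PhiISqrtInv {mdc : Fin (r + 1) → ℕ}
    (φ : ∀ i : Fin (r + 1), Mat r n → Matrix (Fin (mdc i + 1)) (Fin (mdc i + 1)) ℝ) :
    Matrix (DIdx r mdc) (DIdx r mdc) ℝ :=
  Matrix.diagonal fun p => (PhiMat φ (1 : Mat r n) p p) ^ (-(1 / 2) : ℝ)

section Development

section Algebra

theorem blk_apply (x : Mat r n) (l k : Fin (r + 1)) (a : Fin (n l)) (b : Fin (n k)) :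
    blk x l k a b = x ⟨l, a⟩ ⟨k, b⟩ := rfl

theorem ext_blk {x y : Mat r n} (h : ∀ l k, blk x l k = blk y l k) : x = y := by
  ext ⟨l, a⟩ ⟨k, b⟩
  exact congrFun (congrFun (h l k) a) b

theorem blk_mul (x y : Mat r n) (l k : Fin (r + 1)) :
    blk (x * y) l k = ∑ j, blk x l j * blk y j k := by
  ext a b
  simp only [blk_apply, Matrix.mul_apply, Fintype.sum_sigma, Matrix.sum_apply]

theorem blk_transpose (x : Mat r n) (l k : Fin (r + 1)) : blk xᵀ l k = (blk x k l)ᵀ := rfl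

theorem blk_add (x y : Mat r n) (l k : Fin (r + 1)) :
    blk (x + y) l k = blk x l k + blk y l k := rfl

theorem blk_smul (c : ℝ) (x : Mat r n) (l k : Fin (r + 1)) :
    blk (c • x) l k = c • blk x l k := rfl

theorem scalar_blk_iff {x : Mat r n} {k : Fin (r + 1)} {t : ℝ} :
    (∀ a b : Fin (n k), x ⟨k, a⟩ ⟨k, b⟩ = if a = b then t else 0) ↔ blk x k k = t • 1 := by
  constructor
  · intro h
    ext a b
    simp [blk_apply, h, Matrix.one_apply]
  · intro h a b
    have := congrFun (congrFun h a) b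
    simpa [blk_apply, Matrix.one_apply] using this

/-- The orthogonal projection onto the `k`-th block of coordinates. -/
def blkProj (k : Fin (r + 1)) : Mat r n := Matrix.diagonal fun p => if p.1 = k then 1 else 0

theorem blkProj_transpose (k : Fin (r + 1)) : (blkProj k : Mat r n)ᵀ = blkProj k := by
  simp [blkProj]

theorem blkProj_mul_self (k : Fin (r + 1)) :
    (blkProj k : Mat r n) * blkProj k = blkProj k := by
  simp [blkProj]

theorem mul_blkProj_apply (x : Mat r n) (k : Fin (r + 1)) (p q : Idx r n) :
    (x * blkProj k : Mat r n) p q = if q.1 = k then x p q else 0 := by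
  simp [blkProj]

theorem blkProj_mul_apply (x : Mat r n) (k : Fin (r + 1)) (p q : Idx r n) :
    (blkProj k * x : Mat r n) p q = if p.1 = k then x p q else 0 := by
  simp [blkProj]

theorem trace_blkProj (k : Fin (r + 1)) : (blkProj k : Mat r n).trace = n k := by
  simp only [blkProj, Matrix.trace, Matrix.diag, Matrix.diagonal_apply_eq, Fintype.sum_sigma]
  rw [Finset.sum_eq_single k (fun j _ h => by simp [h]) (by simp)]
  simp

variable (V : ∀ l k : Fin (r + 1), Submodule ℝ (Matrix (Fin (n l)) (Fin (n k)) ℝ))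

/-- The algebra of block lower triangular matrices with strictly lower blocks in `𝒱_{lk}`
and scalar diagonal blocks. -/
def lowAlg : Submodule ℝ (Mat r n) where
  carrier := {T | (∀ k l : Fin (r + 1), l < k → blk T l k = 0) ∧
    (∀ k l : Fin (r + 1), k < l → blk T l k ∈ V l k) ∧
    ∀ k : Fin (r + 1), ∃ t : ℝ, blk T k k = t • 1}
  zero_mem' := ⟨fun _ _ _ => rfl, fun _ _ _ => Submodule.zero_mem _, fun k => ⟨0, by
    ext; simp [blk_apply]⟩⟩
  add_mem' := by
    rintro S T ⟨h1, h2, h3⟩ ⟨g1, g2, g3⟩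
    refine ⟨fun k l h => ?_, fun k l h => ?_, fun k => ?_⟩
    · rw [blk_add, h1 k l h, g1 k l h, add_zero]
    · exact Submodule.add_mem _ (h2 k l h) (g2 k l h)
    · obtain ⟨t, ht⟩ := h3 k
      obtain ⟨u, hu⟩ := g3 k
      exact ⟨t + u, by rw [blk_add, ht, hu, add_smul]⟩
  smul_mem' := by
    rintro c T ⟨h1, h2, h3⟩
    refine ⟨fun k l h => ?_, fun k l h => ?_, fun k => ?_⟩
    · rw [blk_smul, h1 k l h, smul_zero]
    · exact Submodule.smul_mem _ c (h2 k l h)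
    · obtain ⟨t, ht⟩ := h3 k
      exact ⟨c * t, by rw [blk_smul, ht, smul_smul]⟩

/-- The space `𝒵` as a submodule. -/
def Zsub : Submodule ℝ (Mat r n) where
  carrier := {x | xᵀ = x ∧ (∀ k l : Fin (r + 1), k < l → blk x l k ∈ V l k) ∧
    ∀ k : Fin (r + 1), ∃ c : ℝ, blk x k k = c • 1}
  zero_mem' := ⟨by simp, fun _ _ _ => Submodule.zero_mem _, fun k => ⟨0, by
    ext; simp [blk_apply]⟩⟩
  add_mem' := by
    rintro S T ⟨h1, h2, h3⟩ ⟨g1, g2, g3⟩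
    refine ⟨?_, fun k l h => ?_, fun k => ?_⟩
    · rw [Matrix.transpose_add, h1, g1]
    · exact Submodule.add_mem _ (h2 k l h) (g2 k l h)
    · obtain ⟨t, ht⟩ := h3 k
      obtain ⟨u, hu⟩ := g3 k
      exact ⟨t + u, by rw [blk_add, ht, hu, add_smul]⟩
  smul_mem' := by
    rintro c T ⟨h1, h2, h3⟩
    refine ⟨?_, fun k l h => ?_, fun k => ?_⟩
    · rw [Matrix.transpose_smul, h1]
    · exact Submodule.smul_mem _ c (h2 k l h)
    · obtain ⟨t, ht⟩ := h3 k
      exact ⟨c * t, by rw [blk_smul, ht, smul_smul]⟩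

/-- Strictly lower triangular elements of `lowAlg` supported on the `k`-th block column. -/
def colSub (k : Fin (r + 1)) : Submodule ℝ (Mat r n) where
  carrier := {w | w ∈ lowAlg V ∧ w * blkProj k = w ∧ blkProj k * w = 0}
  zero_mem' := ⟨Submodule.zero_mem _, by simp, by simp⟩
  add_mem' := by
    rintro S T ⟨h1, h2, h3⟩ ⟨g1, g2, g3⟩
    exact ⟨Submodule.add_mem _ h1 g1, by rw [add_mul, h2, g2], by rw [mul_add, h3, g3, add_zero]⟩
  smul_mem' := by
    rintro c T ⟨h1, h2, h3⟩
    exact ⟨Submodule.smul_mem _ c h1, by rw [smul_mul_assoc, h2],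
      by rw [mul_smul_comm, h3, smul_zero]⟩

variable {V}

theorem mem_Zspace_iff {x : Mat r n} : x ∈ Zspace V ↔ x ∈ Zsub V := by
  simp only [Zspace, Set.mem_ofPred_eq, scalar_blk_iff]
  exact Iff.rfl

theorem blk_diag {T : Mat r n} (hT : T ∈ lowAlg V) (k : Fin (r + 1)) :
    blk T k k = tdiag T k • 1 := by
  obtain ⟨t, ht⟩ := hT.2.2 k
  have : tdiag T k = t := by
    have := scalar_blk_iff.2 ht ⟨0, (n k).2⟩ ⟨0, (n k).2⟩
    simpa [tdiag] using this
  rw [ht, this]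

theorem blk_diag_Z {x : Mat r n} (hx : x ∈ Zsub V) (k : Fin (r + 1)) :
    blk x k k = tdiag x k • 1 := by
  obtain ⟨t, ht⟩ := hx.2.2 k
  have : tdiag x k = t := by
    have := scalar_blk_iff.2 ht ⟨0, (n k).2⟩ ⟨0, (n k).2⟩
    simpa [tdiag] using this
  rw [ht, this]

theorem tdiag_eq_of_blk {x : Mat r n} {k : Fin (r + 1)} {t : ℝ} (h : blk x k k = t • 1) :
    tdiag x k = t := by
  have := scalar_blk_iff.2 h ⟨0, (n k).2⟩ ⟨0, (n k).2⟩
  simpa [tdiag] using this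

theorem mem_Hgrp_iff {T : Mat r n} : T ∈ Hgrp V ↔ T ∈ lowAlg V ∧ ∀ k, 0 < tdiag T k := by
  constructor
  · rintro ⟨h1, h2, h3⟩
    refine ⟨⟨h1, h2, fun k => ?_⟩, fun k => ?_⟩
    · obtain ⟨t, -, ht⟩ := h3 k
      exact ⟨t, scalar_blk_iff.1 ht⟩
    · obtain ⟨t, h0, ht⟩ := h3 k
      rwa [tdiag_eq_of_blk (scalar_blk_iff.1 ht)]
  · rintro ⟨h, h0⟩
    exact ⟨h.1, h.2.1, fun k => ⟨tdiag T k, h0 k, scalar_blk_iff.2 (blk_diag h k)⟩⟩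

theorem lowAlg_blk_mul {S T : Mat r n} (hS : S ∈ lowAlg V) (hT : T ∈ lowAlg V)
    (k : Fin (r + 1)) : blk (S * T) k k = (tdiag S k * tdiag T k) • 1 := by
  rw [blk_mul, Finset.sum_eq_single k, blk_diag hS, blk_diag hT]
  · simp [smul_smul, mul_comm]
  · intro j _ hj
    rcases lt_or_gt_of_ne hj with h | h
    · rw [hT.1 k j h, Matrix.mul_zero]
    · rw [hS.1 j k h, Matrix.zero_mul]
  · simp

theorem lowAlg_mul (hV1 : CondV1 V) {S T : Mat r n} (hS : S ∈ lowAlg V) (hT : T ∈ lowAlg V) :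
    S * T ∈ lowAlg V := by
  refine ⟨fun k l h => ?_, fun k l h => ?_, fun k => ⟨_, lowAlg_blk_mul hS hT k⟩⟩
  · rw [blk_mul]
    refine Finset.sum_eq_zero fun j _ => ?_
    rcases lt_or_ge l j with h' | h'
    · rw [hS.1 j l h', Matrix.zero_mul]
    · rw [hT.1 k j (lt_of_le_of_lt h' h), Matrix.mul_zero]
  · rw [blk_mul]
    refine Submodule.sum_mem _ fun j _ => ?_
    rcases lt_trichotomy l j with h' | rfl | h'
    · rw [hS.1 j l h', Matrix.zero_mul]
      exact Submodule.zero_mem _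
    · rw [blk_diag hS, Matrix.smul_mul, Matrix.one_mul]
      exact Submodule.smul_mem _ _ (hT.2.1 k l h)
    · rcases lt_trichotomy k j with g | rfl | g
      · exact hV1 k j l g h' _ (hS.2.1 j l h') _ (hT.2.1 k j g)
      · rw [blk_diag hT, Matrix.mul_smul, Matrix.mul_one]
        exact Submodule.smul_mem _ _ (hS.2.1 k l h)
      · rw [hT.1 k j g, Matrix.mul_zero]
        exact Submodule.zero_mem _

theorem tdiag_mul {S T : Mat r n} (hS : S ∈ lowAlg V) (hT : T ∈ lowAlg V) (k : Fin (r + 1)) :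
    tdiag (S * T) k = tdiag S k * tdiag T k :=
  tdiag_eq_of_blk (lowAlg_blk_mul hS hT k)

theorem tdiag_add (S T : Mat r n) (k : Fin (r + 1)) :
    tdiag (S + T) k = tdiag S k + tdiag T k := rfl

theorem tdiag_sub (S T : Mat r n) (k : Fin (r + 1)) :
    tdiag (S - T) k = tdiag S k - tdiag T k := rfl

theorem tdiag_smul (c : ℝ) (T : Mat r n) (k : Fin (r + 1)) :
    tdiag (c • T) k = c * tdiag T k := rfl

theorem tdiag_one (k : Fin (r + 1)) : tdiag (1 : Mat r n) k = 1 := by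
  simp [tdiag]

theorem tdiag_blkProj (j k : Fin (r + 1)) :
    tdiag (blkProj j : Mat r n) k = if k = j then 1 else 0 := by
  simp [tdiag, blkProj]

theorem diagonal_mem_lowAlg (c : Fin (r + 1) → ℝ) :
    (Matrix.diagonal fun p : Idx r n => c p.1) ∈ lowAlg V := by
  have off : ∀ l k : Fin (r + 1), l ≠ k →
      blk (Matrix.diagonal fun p : Idx r n => c p.1) l k = 0 := by
    intro l k h
    ext a b
    rw [blk_apply, Matrix.diagonal_apply_ne]
    · rfl
    · intro h'
      exact h (congrArg Sigma.fst h')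
  refine ⟨fun k l h => off l k h.ne, fun k l h => ?_, fun k => ⟨c k, ?_⟩⟩
  · rw [off l k h.ne']
    exact Submodule.zero_mem _
  · ext a b
    simp [blk_apply, Matrix.diagonal_apply, Matrix.one_apply]

theorem one_mem_lowAlg : (1 : Mat r n) ∈ lowAlg V := by
  have := diagonal_mem_lowAlg (V := V) (fun _ => 1)
  rwa [Matrix.diagonal_one] at this

theorem blkProj_mem_lowAlg (k : Fin (r + 1)) : (blkProj k : Mat r n) ∈ lowAlg V :=
  diagonal_mem_lowAlg (V := V) (fun j => if j = k then 1 else 0)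

theorem one_mem_Hgrp : (1 : Mat r n) ∈ Hgrp V :=
  mem_Hgrp_iff.2 ⟨one_mem_lowAlg, fun k => by simp [tdiag_one]⟩

theorem Hgrp_mul (hV1 : CondV1 V) {S T : Mat r n} (hS : S ∈ Hgrp V) (hT : T ∈ Hgrp V) :
    S * T ∈ Hgrp V := by
  rw [mem_Hgrp_iff] at *
  exact ⟨lowAlg_mul hV1 hS.1 hT.1, fun k => by
    rw [tdiag_mul hS.1 hT.1]; exact mul_pos (hS.2 k) (hT.2 k)⟩

theorem mul_transpose_self_mem (hV2 : CondV2 V) (hV3 : CondV3 V) {T : Mat r n}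
    (hT : T ∈ lowAlg V) : T * Tᵀ ∈ Zsub V := by
  refine ⟨by simp, fun k l h => ?_, fun l => ?_⟩
  · rw [blk_mul]
    refine Submodule.sum_mem _ fun j _ => ?_
    rw [blk_transpose]
    rcases lt_trichotomy j k with h' | rfl | h'
    · exact hV2 j k l h' h _ (hT.2.1 j l (h'.trans h)) _ (hT.2.1 j k h')
    · rw [blk_diag hT, Matrix.transpose_smul, Matrix.transpose_one, Matrix.mul_smul,
        Matrix.mul_one]
      exact Submodule.smul_mem _ _ (hT.2.1 j l h)
    · rw [hT.1 j k h', Matrix.transpose_zero, Matrix.mul_zero]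
      exact Submodule.zero_mem _
  · have key : ∀ j, ∃ c : ℝ, blk T l j * blk Tᵀ j l = c • 1 := by
      intro j
      rw [blk_transpose]
      rcases lt_trichotomy j l with h' | rfl | h'
      · exact hV3 j l h' _ (hT.2.1 j l h')
      · exact ⟨tdiag T j * tdiag T j, by rw [blk_diag hT]; simp [smul_smul]⟩
      · exact ⟨0, by rw [hT.1 j l h']; simp⟩
    choose c hc using key
    exact ⟨∑ j, c j, by rw [blk_mul, Finset.sum_congr rfl fun j _ => hc j, Finset.sum_smul]⟩

theorem mul_transpose_add_mem (hV2 : CondV2 V) (hV3 : CondV3 V) {S T : Mat r n}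
    (hS : S ∈ lowAlg V) (hT : T ∈ lowAlg V) : S * Tᵀ + T * Sᵀ ∈ Zsub V := by
  have h : S * Tᵀ + T * Sᵀ = (S + T) * (S + T)ᵀ - S * Sᵀ - T * Tᵀ := by
    rw [Matrix.transpose_add]
    noncomm_ring
  rw [h]
  exact Submodule.sub_mem _ (Submodule.sub_mem _
    (mul_transpose_self_mem hV2 hV3 (Submodule.add_mem _ hS hT))
    (mul_transpose_self_mem hV2 hV3 hS)) (mul_transpose_self_mem hV2 hV3 hT)

theorem add_transpose_mem (hV2 : CondV2 V) (hV3 : CondV3 V) {S : Mat r n}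
    (hS : S ∈ lowAlg V) : S + Sᵀ ∈ Zsub V := by
  simpa using mul_transpose_add_mem hV2 hV3 hS one_mem_lowAlg

theorem exists_lowAlg_add_transpose {x : Mat r n} (hx : x ∈ Zsub V) :
    ∃ A ∈ lowAlg V, x = A + Aᵀ := by
  refine ⟨Matrix.of fun p q => if q.1 < p.1 then x p q else if p.1 = q.1 then x p q / 2 else 0,
    ⟨fun k l h => ?_, fun k l h => ?_, fun k => ?_⟩, ?_⟩
  · ext a b
    simp [blk_apply, h.not_gt, h.ne]
  · convert hx.2.1 k l h using 1
    ext a b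
    simp [blk_apply, h]
  · refine ⟨tdiag x k / 2, ?_⟩
    ext a b
    have := congrFun (congrFun (blk_diag_Z hx k) a) b
    simp only [blk_apply] at this
    simp [blk_apply, this]
    ring
  · ext p q
    have hs : x q p = x p q := congrFun (congrFun hx.1 p) q
    simp only [Matrix.add_apply, Matrix.transpose_apply, Matrix.of_apply, hs]
    rcases lt_trichotomy p.1 q.1 with h | h | h
    · simp [h, h.not_gt, h.ne]
    · simp [h]
    · simp [h, h.not_gt, h.ne]

theorem rhoM_mem (hV1 : CondV1 V) (hV2 : CondV2 V) (hV3 : CondV3 V) {T x : Mat r n}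
    (hT : T ∈ lowAlg V) (hx : x ∈ Zsub V) : T * x * Tᵀ ∈ Zsub V := by
  obtain ⟨A, hA, rfl⟩ := exists_lowAlg_add_transpose hx
  have := mul_transpose_add_mem hV2 hV3 (lowAlg_mul hV1 hT hA) hT
  convert this using 1
  rw [Matrix.transpose_mul]
  noncomm_ring

theorem det_ne_zero {T : Mat r n} (hT : T ∈ Hgrp V) : T.det ≠ 0 := by
  rw [mem_Hgrp_iff] at hT
  have hb : Matrix.BlockTriangular Tᵀ (fun p : Idx r n => p.1) := by
    rintro ⟨l, a⟩ ⟨k, b⟩ h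
    exact congrFun (congrFun (hT.1.1 l k h) b) a
  rw [← Matrix.det_transpose, hb.det_fintype, Finset.prod_ne_zero_iff]
  intro k _
  have : Tᵀ.toSquareBlock (fun p : Idx r n => p.1) k = tdiag T k • 1 := by
    ext ⟨⟨l, a⟩, ha⟩ ⟨⟨l', b⟩, hb⟩
    obtain rfl : l = k := ha
    obtain rfl : l' = l := hb
    have := congrFun (congrFun (blk_diag hT.1 l') b) a
    simp only [blk_apply] at this
    simp [Matrix.toSquareBlock_def, this, Matrix.one_apply, eq_comm]
  rw [this, Matrix.det_smul, Matrix.det_one, mul_one]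
  exact pow_ne_zero _ (hT.2 k).ne'

theorem colSub_mul (hV1 : CondV1 V) {T u : Mat r n} {k : Fin (r + 1)} (hT : T ∈ lowAlg V)
    (hu : u ∈ colSub V k) : T * u ∈ colSub V k := by
  have hm := lowAlg_mul hV1 hT hu.1
  refine ⟨hm, by rw [mul_assoc, hu.2.1], ?_⟩
  have hu0 : ∀ q, blk u k q = 0 := by
    intro q
    ext a b
    have := congrFun (congrFun hu.2.2 ⟨k, a⟩) ⟨q, b⟩
    rwa [blkProj_mul_apply, if_pos rfl] at this
  ext ⟨l, a⟩ ⟨q, b⟩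
  rw [blkProj_mul_apply]
  split_ifs with h
  · obtain rfl : l = k := h
    rcases eq_or_ne q l with rfl | hq
    · have h1 := congrFun (congrFun (lowAlg_blk_mul hT hu.1 q) a) b
      have h2 : tdiag u q = 0 := tdiag_eq_of_blk (by rw [hu0, zero_smul])
      simpa [h2, blk_apply] using h1
    · have := congrFun (congrFun (show T * u * blkProj l = T * u by rw [mul_assoc, hu.2.1])
        ⟨l, a⟩) ⟨q, b⟩
      rw [mul_blkProj_apply, if_neg hq] at this
      exact this.symm
  · rfl

theorem exists_colSub_mul_eq (hV1 : CondV1 V) {T v : Mat r n} {k : Fin (r + 1)}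
    (hT : T ∈ Hgrp V) (hv : v ∈ colSub V k) : ∃ u ∈ colSub V k, T * u = v := by
  let f : colSub V k →ₗ[ℝ] colSub V k :=
    (LinearMap.mulLeft ℝ T).restrict fun u hu => colSub_mul hV1 (mem_Hgrp_iff.1 hT).1 hu
  have hf : Function.Injective f := by
    rintro ⟨x, hx⟩ ⟨y, hy⟩ h
    have h' : T * x = T * y := congrArg Subtype.val h
    have hdet := (Matrix.isUnit_iff_isUnit_det T).2 (isUnit_iff_ne_zero.2 (det_ne_zero hT))
    exact Subtype.ext (hdet.mul_right_injective h')
  obtain ⟨u, hu⟩ := LinearMap.injective_iff_surjective.1 hf ⟨v, hv⟩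
  exact ⟨u, u.2, congrArg Subtype.val hu⟩

end Algebra

section Cone

variable (V : ∀ l k : Fin (r + 1), Submodule ℝ (Matrix (Fin (n l)) (Fin (n k)) ℝ))

/-- Positive semidefinite elements of `𝒵`. -/
def psdCone : Set (Mat r n) := {x | x ∈ Zsub V ∧ x.PosSemidef}

/-- Matrices whose block rows with index `< k` vanish. -/
def SuppGE (k : ℕ) (x : Mat r n) : Prop := ∀ p q : Idx r n, p.1.val < k → x p q = 0

/-- The part of the `k`-th block column strictly below the diagonal. -/
def colPart (k : Fin (r + 1)) (x : Mat r n) : Mat r n :=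
  Matrix.of fun p q => if q.1 = k ∧ k < p.1 then x p q else 0

variable {V}

theorem continuous_quad (v : Idx r n → ℝ) : Continuous fun x : Mat r n => v ⬝ᵥ (x *ᵥ v) := by
  fun_prop

theorem posSemidef_iff_quad {x : Mat r n} (hx : x ∈ Zsub V) :
    x.PosSemidef ↔ ∀ v, 0 ≤ v ⬝ᵥ (x *ᵥ v) := by
  rw [Matrix.posSemidef_iff_dotProduct_mulVec]
  simp only [star_trivial]
  exact ⟨fun h => fun v => h.2 v, fun h => ⟨by
    rw [Matrix.IsHermitian, Matrix.conjTranspose_eq_transpose_of_trivial]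
    exact hx.1, fun v => h v⟩⟩

theorem one_mem_Zsub : (1 : Mat r n) ∈ Zsub V := by
  refine ⟨by simp, fun k l h => ?_, fun k => ⟨1, ?_⟩⟩
  · exact one_mem_lowAlg.2.1 k l h
  · rw [blk_diag (V := V) one_mem_lowAlg, tdiag_one]

theorem isClosed_psdCone : IsClosed (psdCone V) := by
  have : psdCone V = (Zsub V : Set (Mat r n)) ∩ ⋂ v, {x | 0 ≤ v ⬝ᵥ (x *ᵥ v)} := by
    ext x
    simp only [psdCone, Set.mem_inter_iff, Set.mem_iInter, SetLike.mem_coe]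
    constructor
    · rintro ⟨h, h'⟩
      exact ⟨h, (posSemidef_iff_quad h).1 h'⟩
    · rintro ⟨h, h'⟩
      exact ⟨h, (posSemidef_iff_quad h).2 h'⟩
  rw [this]
  exact (Submodule.closed_of_finiteDimensional _).inter
    (isClosed_iInter fun v => isClosed_le continuous_const (continuous_quad v))

theorem closure_Pcone : closure (Pcone V) = psdCone V := by
  apply Set.Subset.antisymm
  · refine closure_minimal ?_ isClosed_psdCone
    rintro x ⟨h, h'⟩
    exact ⟨mem_Zspace_iff.1 h, h'.posSemidef⟩
  · rintro x ⟨h, h'⟩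
    have ht : Filter.Tendsto (fun m : ℕ => x + (1 / ((m : ℝ) + 1)) • (1 : Mat r n)) Filter.atTop
        (nhds (x + (0 : ℝ) • (1 : Mat r n))) :=
      tendsto_const_nhds.add (tendsto_one_div_add_atTop_nhds_zero_nat.smul tendsto_const_nhds)
    rw [zero_smul, add_zero] at ht
    refine mem_closure_of_tendsto ht (Filter.Eventually.of_forall fun m => ⟨?_, ?_⟩)
    · rw [mem_Zspace_iff]
      exact Submodule.add_mem _ h (Submodule.smul_mem _ _ one_mem_Zsub)
    · exact Matrix.PosDef.posSemidef_add h' (Matrix.PosDef.one.smul (by positivity))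

theorem mul_transpose_self_mem_psdCone (hV2 : CondV2 V) (hV3 : CondV3 V) {T : Mat r n}
    (hT : T ∈ lowAlg V) : T * Tᵀ ∈ psdCone V :=
  ⟨mul_transpose_self_mem hV2 hV3 hT, by
    simpa using Matrix.posSemidef_self_mul_conjTranspose T⟩

theorem rhoM_mem_psdCone (hV1 : CondV1 V) (hV2 : CondV2 V) (hV3 : CondV3 V) {T x : Mat r n}
    (hT : T ∈ lowAlg V) (hx : x ∈ psdCone V) : T * x * Tᵀ ∈ psdCone V :=
  ⟨rhoM_mem hV1 hV2 hV3 hT hx.1, by simpa using hx.2.mul_mul_conjTranspose_same T⟩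

theorem trace_pos_of_mem {x : Mat r n} (hx : x ∈ psdCone V) (h0 : x ≠ 0) : 0 < x.trace :=
  lt_of_le_of_ne hx.2.trace_nonneg fun h => h0 (hx.2.trace_eq_zero_iff.1 h.symm)

theorem trace_rhoM_pos (hV1 : CondV1 V) (hV2 : CondV2 V) (hV3 : CondV3 V) {T x : Mat r n}
    (hT : T ∈ Hgrp V) (hx : x ∈ psdCone V) (h0 : x ≠ 0) : 0 < (T * x * Tᵀ).trace := by
  refine trace_pos_of_mem (rhoM_mem_psdCone hV1 hV2 hV3 (mem_Hgrp_iff.1 hT).1 hx) fun h => h0 ?_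
  have h1 : IsUnit T := (Matrix.isUnit_iff_isUnit_det T).2 (isUnit_iff_ne_zero.2 (det_ne_zero hT))
  have h2 : IsUnit Tᵀ := (Matrix.isUnit_transpose T).2 h1
  rwa [h2.mul_left_eq_zero, h1.mul_right_eq_zero] at h

theorem tdiag_nonneg {x : Mat r n} (hx : x ∈ psdCone V) (k : Fin (r + 1)) : 0 ≤ tdiag x k :=
  hx.2.diag_nonneg

theorem suppGE_succ_of_tdiag_eq_zero {x : Mat r n} (hx : x ∈ psdCone V) {k : Fin (r + 1)}
    (hs : SuppGE k x) (h0 : tdiag x k = 0) : SuppGE (k + 1) x := by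
  rintro ⟨l, a⟩ q hl
  rcases Nat.lt_succ_iff_lt_or_eq.1 hl with h | h
  · exact hs _ _ h
  · obtain rfl : l = k := Fin.ext h
    have h1 : x ⟨l, a⟩ ⟨l, a⟩ = 0 := by
      have := congrFun (congrFun (blk_diag_Z hx.1 l) a) a
      simpa [h0, blk_apply] using this
    have h2 := (hx.2.dotProduct_mulVec_zero_iff (Pi.single ⟨l, a⟩ 1)).1 (by simp [h1])
    have h3 := congrFun h2 q
    have h4 := congrFun (congrFun hx.1.1 q) ⟨l, a⟩
    rw [Matrix.transpose_apply] at h4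
    rw [h4]
    simpa using h3

theorem mem_colSub_iff {k : Fin (r + 1)} {w : Mat r n} : w ∈ colSub V k ↔
    (∀ l q, (q ≠ k ∨ l ≤ k) → blk w l q = 0) ∧ ∀ l, k < l → blk w l k ∈ V l k := by
  constructor
  · rintro ⟨h1, h2, h3⟩
    refine ⟨fun l q h => ?_, fun l h => h1.2.1 k l h⟩
    by_cases hq : q = k
    · subst hq
      have hl : l ≤ q := h.resolve_left (by simp)
      rcases hl.lt_or_eq with h' | rfl
      · exact h1.1 q l h'
      · ext a b
        have := congrFun (congrFun h3 ⟨l, a⟩) ⟨l, b⟩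
        rwa [blkProj_mul_apply, if_pos rfl] at this
    · ext a b
      have := congrFun (congrFun h2 ⟨l, a⟩) ⟨q, b⟩
      rw [mul_blkProj_apply, if_neg hq] at this
      exact this.symm
  · rintro ⟨h1, h2⟩
    have e : ∀ p q : Idx r n, (q.1 ≠ k ∨ p.1 ≤ k) → w p q = 0 := by
      rintro ⟨l, a⟩ ⟨q, b⟩ h
      exact congrFun (congrFun (h1 l q h) a) b
    refine ⟨⟨fun q l h => ?_, fun q l h => ?_, fun l => ⟨0, ?_⟩⟩, ?_, ?_⟩
    · apply h1
      by_cases hq : q = k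
      · exact Or.inr (hq ▸ h.le)
      · exact Or.inl hq
    · by_cases hq : q = k
      · subst hq
        exact h2 l h
      · rw [h1 l q (Or.inl hq)]
        exact Submodule.zero_mem _
    · rw [zero_smul]
      apply h1
      by_cases hq : l = k
      · exact Or.inr hq.le
      · exact Or.inl hq
    · ext p q
      rw [mul_blkProj_apply]
      split_ifs with h
      · rfl
      · exact (e p q (Or.inl h)).symm
    · ext p q
      rw [blkProj_mul_apply]
      split_ifs with h
      · exact e p q (Or.inr h.le)
      · rfl

theorem colPart_mem {k : Fin (r + 1)} {x : Mat r n} (hx : x ∈ Zsub V) :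
    colPart k x ∈ colSub V k := by
  rw [mem_colSub_iff]
  refine ⟨fun l q h => ?_, fun l h => ?_⟩
  · ext a b
    simp only [colPart, blk_apply, Matrix.of_apply, Matrix.zero_apply, ite_eq_right_iff]
    rintro ⟨h1, h2⟩
    exact absurd h (by simp [h1, h2])
  · convert hx.2.1 k l h using 1
    ext a b
    simp [colPart, blk_apply, h]

theorem mul_blkProj_of_suppGE {k : Fin (r + 1)} {x : Mat r n} (hx : x ∈ Zsub V)
    (hs : SuppGE k x) : x * blkProj k = tdiag x k • (blkProj k : Mat r n) + colPart k x := by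
  ext ⟨l, a⟩ ⟨q, b⟩
  rw [mul_blkProj_apply, Matrix.add_apply, Matrix.smul_apply]
  simp only [colPart, Matrix.of_apply, blkProj, Matrix.diagonal_apply, smul_eq_mul]
  by_cases hq : q = k
  · subst hq
    rcases lt_trichotomy l q with h | rfl | h
    · have : (⟨l, a⟩ : Idx r n) ≠ ⟨q, b⟩ := fun h' => h.ne (congrArg Sigma.fst h')
      simp [hs ⟨l, a⟩ ⟨q, b⟩ h, this, h.not_gt]
    · have := congrFun (congrFun (blk_diag_Z hx l) a) b
      simp only [blk_apply] at this
      simp [this, Matrix.one_apply]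
    · have : (⟨l, a⟩ : Idx r n) ≠ ⟨q, b⟩ := fun h' => h.ne' (congrArg Sigma.fst h')
      simp [this, h]
  · simp only [hq, if_false, false_and, add_zero]
    split_ifs with h h'
    · exact absurd ((congrArg Sigma.fst h).symm.trans h') hq
    · simp
    · simp

theorem blkProj_mem_Zsub (k : Fin (r + 1)) : (blkProj k : Mat r n) ∈ Zsub V :=
  ⟨blkProj_transpose k, (blkProj_mem_lowAlg k).2⟩

theorem suppGE_remainder {k : Fin (r + 1)} {x : Mat r n} (hx : x ∈ Zsub V)
    (hs : SuppGE k x) :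
    SuppGE (k + 1) (x - tdiag x k • (blkProj k : Mat r n) - colPart k x - (colPart k x)ᵀ) := by
  have h1 := mul_blkProj_of_suppGE hx hs
  have hc : (blkProj k : Mat r n) * colPart k x = 0 := (colPart_mem hx).2.2
  have hc' : colPart k x * (blkProj k : Mat r n) = colPart k x := (colPart_mem hx).2.1
  have h2 : (blkProj k : Mat r n) * x = tdiag x k • (blkProj k : Mat r n) + (colPart k x)ᵀ := by
    have := congrArg Matrix.transpose h1
    rwa [Matrix.transpose_mul, hx.1, Matrix.transpose_add, Matrix.transpose_smul,
      blkProj_transpose] at this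
  have hc'' : (blkProj k : Mat r n) * (colPart k x)ᵀ = (colPart k x)ᵀ := by
    have := congrArg Matrix.transpose hc'
    rwa [Matrix.transpose_mul, blkProj_transpose] at this
  have h3 : (blkProj k : Mat r n) *
      (x - tdiag x k • (blkProj k : Mat r n) - colPart k x - (colPart k x)ᵀ) = 0 := by
    rw [mul_sub, mul_sub, mul_sub, h2, hc, hc'', mul_smul_comm, blkProj_mul_self]
    abel
  intro p q hp
  rcases Nat.lt_succ_iff_lt_or_eq.1 hp with h | h
  · have g1 : p.1 ≠ k := fun h' => by rw [h'] at h; exact lt_irrefl _ h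
    have g2 : ¬ k < p.1 := fun h' => by
      have : k.val < p.1.val := h'
      omega
    have g3 : x q p = 0 := by
      have := congrFun (congrFun hx.1 p) q
      rw [Matrix.transpose_apply] at this
      rw [this]
      exact hs p q h
    have g4 : (blkProj k : Mat r n) p q = 0 := by
      simp only [blkProj, Matrix.diagonal_apply, g1, if_false, ite_self]
    simp [colPart, hs p q h, g1, g2, g4]
  · have := congrFun (congrFun h3 p) q
    rwa [blkProj_mul_apply, if_pos (Fin.ext h)] at this

theorem blkProj_mul_of_suppGE {k : Fin (r + 1)} {x : Mat r n} (hs : SuppGE (k + 1) x) :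
    (blkProj k : Mat r n) * x = 0 := by
  ext p q
  rw [blkProj_mul_apply]
  split_ifs with h
  · exact hs p q (by rw [h]; exact Nat.lt_succ_self _)
  · rfl

theorem trace_colSub_eq_zero {k : Fin (r + 1)} {w : Mat r n} (hw : w ∈ colSub V k) :
    w.trace = 0 := by
  rw [← hw.2.1, Matrix.trace_mul_comm, hw.2.2, Matrix.trace_zero]

theorem trace_mul_transpose_self_nonneg (w : Mat r n) : 0 ≤ (w * wᵀ).trace := by
  have := (Matrix.posSemidef_self_mul_conjTranspose w).trace_nonneg
  simpa using this

theorem trace_mul_transpose_self_eq_zero {w : Mat r n} (h : (w * wᵀ).trace = 0) : w = 0 := by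
  have := Matrix.trace_mul_conjTranspose_self_eq_zero_iff (A := w)
  exact this.1 (by simpa using h)

end Cone

section Orbit

variable {V : ∀ l k : Fin (r + 1), Submodule ℝ (Matrix (Fin (n l)) (Fin (n k)) ℝ)}

/-- Every linear functional on a block column is represented by the trace form twisted by an
element of `H`. -/
theorem exists_colSub_repr (hV1 : CondV1 V) {T : Mat r n} (hT : T ∈ Hgrp V) (k : Fin (r + 1))
    (g : Mat r n →ₗ[ℝ] ℝ) :
    ∃ v ∈ colSub V k, ∀ u ∈ colSub V k, g u = (T * u * vᵀ).trace := by
  let Ψ : colSub V k →ₗ[ℝ] Module.Dual ℝ (colSub V k) :=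
    LinearMap.mk₂ ℝ (fun v u => (T * (u : Mat r n) * (v : Mat r n)ᵀ).trace)
      (fun a b c => by simp [mul_add, Matrix.trace_add])
      (fun a b c => by simp [Matrix.trace_smul])
      (fun a b c => by simp [mul_add, add_mul, Matrix.trace_add])
      (fun a b c => by simp [Matrix.trace_smul])
  have hΨ : Function.Injective Ψ := by
    rw [← LinearMap.ker_eq_bot, LinearMap.ker_eq_bot']
    rintro ⟨v, hv⟩ h
    obtain ⟨u, hu, huv⟩ := exists_colSub_mul_eq hV1 hT hv
    have h1 : (T * u * vᵀ).trace = 0 := LinearMap.congr_fun h ⟨u, hu⟩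
    rw [huv] at h1
    exact Subtype.ext (trace_mul_transpose_self_eq_zero h1)
  obtain ⟨v, hv⟩ := (LinearMap.injective_iff_surjective_of_finrank_eq_finrank
    Subspace.dual_finrank_eq.symm).1 hΨ (g.comp (colSub V k).subtype)
  exact ⟨v, v.2, fun u hu => (LinearMap.congr_fun hv ⟨u, hu⟩).symm⟩

theorem suppGE_colSub_mul_transpose {k : Fin (r + 1)} {u : Mat r n} (hu : u ∈ colSub V k)
    (w : Mat r n) : SuppGE (k + 1) (u * wᵀ) := by
  intro p q hp
  rw [Matrix.mul_apply]
  refine Finset.sum_eq_zero fun j _ => ?_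
  have : u p j = 0 := congrFun (congrFun
    ((mem_colSub_iff.1 hu).1 p.1 j.1 (Or.inr (Nat.lt_succ_iff.1 hp))) p.2) j.2
  rw [this, zero_mul]

theorem exists_Hgrp_of_pos (hV1 : CondV1 V) (hV2 : CondV2 V) (hV3 : CondV3 V)
    (f : Mat r n →ₗ[ℝ] ℝ) (hf : ∀ x ∈ psdCone V, x ≠ 0 → 0 < f x) :
    ∃ T ∈ Hgrp V, ∀ x ∈ Zsub V, f x = (T * x * Tᵀ).trace := by
  suffices H : ∀ m : ℕ, m ≤ r + 1 → ∃ T ∈ Hgrp V, ∀ x ∈ Zsub V, SuppGE (r + 1 - m) x →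
      f x = (T * x * Tᵀ).trace by
    obtain ⟨T, hT, h⟩ := H (r + 1) le_rfl
    refine ⟨T, hT, fun x hx => h x hx fun p q hp => ?_⟩
    simp at hp
  intro m
  induction m with
  | zero =>
    intro _
    refine ⟨1, one_mem_Hgrp, fun x hx hs => ?_⟩
    have : x = 0 := by
      ext p q
      exact hs p q p.1.isLt
    simp [this]
  | succ m ih =>
    intro hm
    obtain ⟨T, hT, hfT⟩ := ih (by omega)
    obtain ⟨k, hk⟩ : ∃ k : Fin (r + 1), k.val = r + 1 - (m + 1) :=
      ⟨⟨r + 1 - (m + 1), by omega⟩, rfl⟩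
    rw [← hk]
    have hk' : r + 1 - m = k.val + 1 := by omega
    rw [hk'] at hfT
    have hTl := (mem_Hgrp_iff.1 hT).1
    obtain ⟨v, hv, hrep⟩ := exists_colSub_repr hV1 hT k
      ((1 / 2 : ℝ) • f.comp (LinearMap.id + (Matrix.transposeLinearEquiv _ _ ℝ ℝ).toLinearMap))
    have hrep' : ∀ u ∈ colSub V k, f u + f uᵀ = 2 * (T * u * vᵀ).trace := by
      intro u hu
      have := hrep u hu
      simp only [LinearMap.smul_apply, LinearMap.comp_apply, LinearMap.add_apply,
        LinearMap.id_apply, smul_eq_mul, map_add] at this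
      have e : f uᵀ = f ((Matrix.transposeLinearEquiv _ _ ℝ ℝ).toLinearMap u) := rfl
      rw [e, ← this]
      ring
    have hP : (blkProj k : Mat r n)ᵀ = blkProj k := blkProj_transpose k
    have hPP : (blkProj k : Mat r n) * blkProj k = blkProj k := blkProj_mul_self k
    have hpos : (v * vᵀ).trace < f (blkProj k) := by
      obtain ⟨u, hu, huv⟩ := exists_colSub_mul_eq hV1 hT (Submodule.neg_mem _ hv)
      have hmem : blkProj k + u ∈ lowAlg V := Submodule.add_mem _ (blkProj_mem_lowAlg k) hu.1
      have huk : (blkProj k : Mat r n) * uᵀ = uᵀ := by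
        have := congrArg Matrix.transpose hu.2.1
        rwa [Matrix.transpose_mul, hP] at this
      have hexp : (blkProj k + u) * (blkProj k + u)ᵀ = blkProj k + (u + uᵀ) + u * uᵀ := by
        rw [Matrix.transpose_add, hP, add_mul, mul_add, mul_add, hPP, huk, hu.2.1]
        abel
      have hne : (blkProj k + u) * (blkProj k + u)ᵀ ≠ 0 := by
        intro h
        have h0 : blkProj k + u = 0 := trace_mul_transpose_self_eq_zero (by rw [h]; simp)
        have h1 := congrArg (fun w => (blkProj k : Mat r n) * w) h0
        simp only [mul_add, hPP, hu.2.2, add_zero, mul_zero] at h1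
        have h2 := trace_blkProj (n := n) k
        rw [h1, Matrix.trace_zero] at h2
        exact absurd h2 (by exact_mod_cast (n k).ne_zero.symm)
      have h1 := hf _ (mul_transpose_self_mem_psdCone hV2 hV3 hmem) hne
      rw [hexp, map_add, map_add, map_add, hrep' u hu, huv,
        hfT _ (mul_transpose_self_mem hV2 hV3 hu.1) (suppGE_colSub_mul_transpose hu u)] at h1
      have h2 : T * (u * uᵀ) * Tᵀ = v * vᵀ := by
        have : T * (u * uᵀ) * Tᵀ = (T * u) * (T * u)ᵀ := by
          rw [Matrix.transpose_mul]
          noncomm_ring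
        rw [this, huv]
        simp
      rw [h2] at h1
      have h3 : (-v * vᵀ).trace = -(v * vᵀ).trace := by simp
      rw [h3] at h1
      linarith
    have hnk : (0 : ℝ) < n k := by exact_mod_cast (n k).pos
    obtain ⟨t, ht0, ht⟩ : ∃ t : ℝ, 0 < t ∧ t * t * n k = f (blkProj k) - (v * vᵀ).trace := by
      refine ⟨Real.sqrt ((f (blkProj k) - (v * vᵀ).trace) / n k),
        Real.sqrt_pos.2 (div_pos (sub_pos.2 hpos) hnk), ?_⟩
      rw [Real.mul_self_sqrt (div_pos (sub_pos.2 hpos) hnk).le, div_mul_cancel₀ _ hnk.ne']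
    set S : Mat r n := T * (1 - blkProj k) + t • blkProj k + v with hS
    have hvP : v * blkProj k = v := hv.2.1
    have hSl : S ∈ lowAlg V := Submodule.add_mem _ (Submodule.add_mem _
      (lowAlg_mul hV1 hTl (Submodule.sub_mem _ one_mem_lowAlg (blkProj_mem_lowAlg k)))
      (Submodule.smul_mem _ _ (blkProj_mem_lowAlg k))) hv.1
    have hvd : ∀ j, tdiag v j = 0 := by
      intro j
      refine tdiag_eq_of_blk ?_
      rw [zero_smul]
      refine (mem_colSub_iff.1 hv).1 j j ?_
      by_cases h : j = k
      · exact Or.inr h.le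
      · exact Or.inl h
    have hSH : S ∈ Hgrp V := by
      refine mem_Hgrp_iff.2 ⟨hSl, fun j => ?_⟩
      rw [hS, tdiag_add, tdiag_add, tdiag_mul hTl
        (Submodule.sub_mem _ one_mem_lowAlg (blkProj_mem_lowAlg k)), tdiag_sub, tdiag_one,
        tdiag_smul, tdiag_blkProj, hvd]
      split_ifs
      · simpa using ht0
      · simpa using (mem_Hgrp_iff.1 hT).2 j
    have hSP : S * blkProj k = t • blkProj k + v := by
      rw [hS, add_mul, add_mul, mul_assoc, sub_mul, one_mul, hPP, sub_self, mul_zero, zero_add,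
        smul_mul_assoc, hPP, hvP]
    have hSy : ∀ y, (blkProj k : Mat r n) * y = 0 → S * y = T * y := by
      intro y hy
      have hvy : v * y = 0 := by rw [← hvP, mul_assoc, hy, mul_zero]
      rw [hS, add_mul, add_mul, hvy, smul_mul_assoc, hy, mul_assoc, sub_mul, hy]
      simp
    refine ⟨S, hSH, fun x hx hs => ?_⟩
    have hb := colPart_mem (k := k) hx
    set b := colPart k x with hbdef
    set c := tdiag x k with hcdef
    set y := x - c • (blkProj k : Mat r n) - b - bᵀ with hydef
    have hyS : SuppGE (k + 1) y := suppGE_remainder hx hs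
    have hyZ : y ∈ Zsub V := by
      have : y = x - c • (blkProj k : Mat r n) - (b + bᵀ) := by rw [hydef]; abel
      rw [this]
      exact Submodule.sub_mem _ (Submodule.sub_mem _ hx (Submodule.smul_mem _ _
        (blkProj_mem_Zsub k))) (add_transpose_mem hV2 hV3 hb.1)
    have hxe : x = c • (blkProj k : Mat r n) + (b + bᵀ) + y := by rw [hydef]; abel
    have hSyS : (S * y * Sᵀ).trace = f y := by
      rw [hfT y hyZ hyS]
      have e1 : S * y = T * y := hSy y (blkProj_mul_of_suppGE hyS)
      have e2 : y * Sᵀ = y * Tᵀ := by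
        have := congrArg Matrix.transpose e1
        rwa [Matrix.transpose_mul, Matrix.transpose_mul, hyZ.1] at this
      rw [e1, mul_assoc, e2, mul_assoc]
    have hSPS : (S * blkProj k * Sᵀ).trace = f (blkProj k) := by
      have e : S * blkProj k * Sᵀ = (S * blkProj k) * (S * blkProj k)ᵀ := by
        rw [Matrix.transpose_mul, hP]
        have : S * blkProj k * Sᵀ = S * (blkProj k * blkProj k) * Sᵀ := by rw [hPP]
        rw [this]
        noncomm_ring
      have e2 : (t • blkProj k + v) * (t • blkProj k + v)ᵀ
          = (t * t) • blkProj k + t • v + t • vᵀ + v * vᵀ := by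
        have hPv : (blkProj k : Mat r n) * vᵀ = vᵀ := by
          have := congrArg Matrix.transpose hvP
          rwa [Matrix.transpose_mul, hP] at this
        rw [Matrix.transpose_add, Matrix.transpose_smul, hP, add_mul, mul_add, mul_add]
        simp only [smul_mul_assoc, mul_smul_comm, hPP, hPv, hvP, smul_smul]
        abel
      rw [e, hSP, e2]
      simp only [Matrix.trace_add, Matrix.trace_smul, Matrix.trace_transpose,
        trace_colSub_eq_zero hv, trace_blkProj, smul_eq_mul]
      linarith
    have hSb : (S * b * Sᵀ).trace = (T * b * vᵀ).trace := by
      have e1 : S * b = T * b := hSy b hb.2.2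
      have hTb := colSub_mul hV1 hTl hb
      have e2 : T * b * Sᵀ = T * b * (S * blkProj k)ᵀ := by
        rw [Matrix.transpose_mul, hP, ← mul_assoc, hTb.2.1]
      rw [e1, e2, hSP, Matrix.transpose_add, Matrix.transpose_smul, hP, mul_add, mul_smul_comm,
        hTb.2.1, Matrix.trace_add, Matrix.trace_smul, trace_colSub_eq_zero hTb, smul_zero,
        zero_add]
    have hSb' : (S * bᵀ * Sᵀ).trace = (T * b * vᵀ).trace := by
      rw [← hSb, ← Matrix.trace_transpose]
      congr 1
      simp only [Matrix.transpose_mul, Matrix.transpose_transpose]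
      noncomm_ring
    have hx2 : S * x * Sᵀ = c • (S * blkProj k * Sᵀ) + (S * b * Sᵀ + S * bᵀ * Sᵀ)
        + S * y * Sᵀ := by
      rw [hxe]
      simp only [mul_add, add_mul, mul_smul_comm, smul_mul_assoc]
    rw [hx2]
    simp only [Matrix.trace_add, Matrix.trace_smul, hSPS, hSb, hSb', hSyS]
    conv_lhs => rw [hxe]
    rw [map_add, map_add, map_smul, map_add, hrep' b hb]
    ring

end Orbit

section Coordinates

theorem det_of_triangular {ι : Type*} [Fintype ι] [LinearOrder ι] {M : ι → Type*}
    [∀ i, AddCommGroup (M i)] [∀ i, Module ℝ (M i)] [∀ i, FiniteDimensional ℝ (M i)]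
    (f : (∀ i, M i) →ₗ[ℝ] ∀ i, M i) (t : ι → ℝ)
    (h0 : ∀ (j : ι) (v : M j) (l : ι), l < j → f (Pi.single j v) l = 0)
    (h1 : ∀ (j : ι) (v : M j), f (Pi.single j v) j = t j • v) :
    LinearMap.det f = ∏ j, t j ^ Module.finrank ℝ (M j) := by
  let b := Pi.basis fun i => Module.finBasis ℝ (M i)
  rw [← LinearMap.det_toMatrix b f, ← Matrix.det_transpose]
  have hA : ∀ p q, LinearMap.toMatrix b b f p q
      = (Module.finBasis ℝ (M p.1)).repr
        (f (Pi.single q.1 (Module.finBasis ℝ (M q.1) q.2)) p.1) p.2 := by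
    rintro ⟨l, i⟩ ⟨j, m⟩
    rw [LinearMap.toMatrix_apply, Pi.basis_repr, Pi.basis_apply]
  have hb : Matrix.BlockTriangular (LinearMap.toMatrix b b f)ᵀ
      (fun p : Σ i, Fin (Module.finrank ℝ (M i)) => p.1) := by
    intro p q h
    rw [Matrix.transpose_apply, hA, h0 _ _ _ h]
    simp
  rw [hb.det_fintype]
  refine Finset.prod_congr rfl fun k _ => ?_
  have : (LinearMap.toMatrix b b f)ᵀ.toSquareBlock
      (fun p : Σ i, Fin (Module.finrank ℝ (M i)) => p.1) k = t k • 1 := by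
    ext ⟨⟨l, i⟩, hl⟩ ⟨⟨j, m⟩, hj⟩
    obtain rfl : l = k := hl
    obtain rfl : j = l := hj
    simp only [Matrix.toSquareBlock_def, Matrix.of_apply, Matrix.transpose_apply]
    rw [hA, h1]
    simp [Matrix.one_apply, Finsupp.single_apply]
  rw [this, Matrix.det_smul, Matrix.det_one, mul_one]
  congr 1
  rw [Fintype.card_congr (Equiv.sigmaSubtype (β := fun i => Fin (Module.finrank ℝ (M i))) k),
    Fintype.card_fin]

variable (V : ∀ l k : Fin (r + 1), Submodule ℝ (Matrix (Fin (n l)) (Fin (n k)) ℝ))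

/-- `dim 𝒱_{lk}` for `k < l`, and `0` otherwise. -/
noncomputable def colDim (k l : Fin (r + 1)) : ℕ :=
  if k < l then Module.finrank ℝ (V l k) else 0

/-- The jacobian of left multiplication by `T` on the `k`-th strictly lower block column. -/
noncomputable def colJac (k : Fin (r + 1)) (T : Mat r n) : ℝ := ∏ l, tdiag T l ^ colDim V k l

/-- The blocks of an element of `colSub`. -/
def colBlocks (k : Fin (r + 1)) :
    colSub V k →ₗ[ℝ] ∀ l : {l : Fin (r + 1) // k < l}, V l.1 k where
  toFun w l := ⟨blk w.1 l.1 k, (mem_colSub_iff.1 w.2).2 l.1 l.2⟩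
  map_add' _ _ := rfl
  map_smul' _ _ := rfl

theorem colBlocks_bijective (k : Fin (r + 1)) : Function.Bijective (colBlocks V k) := by
  constructor
  · rintro ⟨w, hw⟩ ⟨w', hw'⟩ h
    refine Subtype.ext (ext_blk fun l q => ?_)
    by_cases hq : q = k
    · subst hq
      by_cases hl : q < l
      · exact congrArg Subtype.val (congrFun h ⟨l, hl⟩)
      · rw [(mem_colSub_iff.1 hw).1 l q (Or.inr (not_lt.1 hl)),
          (mem_colSub_iff.1 hw').1 l q (Or.inr (not_lt.1 hl))]
    · rw [(mem_colSub_iff.1 hw).1 l q (Or.inl hq), (mem_colSub_iff.1 hw').1 l q (Or.inl hq)]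
  · intro y
    let w : Mat r n := Matrix.of fun p q =>
      if h : q.1 = k then (if h' : k < p.1 then (y ⟨p.1, h'⟩).1 p.2 (h ▸ q.2) else 0) else 0
    have hblk : ∀ (l : Fin (r + 1)) (h : k < l), blk w l k = (y ⟨l, h⟩).1 := by
      intro l h
      ext a b
      simp [w, blk_apply, h]
    have hw : w ∈ colSub V k := by
      rw [mem_colSub_iff]
      refine ⟨fun l q h => ?_, fun l h => ?_⟩
      · ext a b
        simp only [w, blk_apply, Matrix.of_apply, Matrix.zero_apply]
        split_ifs with h1 h2
        · exact absurd h (by simp [h1, h2])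
        · rfl
        · rfl
      · rw [hblk l h]
        exact (y ⟨l, h⟩).2
    exact ⟨⟨w, hw⟩, funext fun l => Subtype.ext (hblk l.1 l.2)⟩

variable {V}

theorem exists_coord (hV1 : CondV1 V) (k : Fin (r + 1)) :
    ∃ (d : ℕ) (J : EuclideanSpace ℝ (Fin d) →ₗ[ℝ] Mat r n), Function.Injective J ∧
      (∀ w, w ∈ colSub V k ↔ ∃ u, J u = w) ∧
      ∀ T ∈ lowAlg V, ∃ φ : EuclideanSpace ℝ (Fin d) →ₗ[ℝ] EuclideanSpace ℝ (Fin d),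
        (∀ u, J (φ u) = T * J u) ∧ LinearMap.det φ = colJac V k T := by
  let Y := ∀ l : {l : Fin (r + 1) // k < l}, V l.1 k
  let e : colSub V k ≃ₗ[ℝ] Y := LinearEquiv.ofBijective (colBlocks V k) (colBlocks_bijective V k)
  let g : EuclideanSpace ℝ (Fin (Module.finrank ℝ Y)) ≃ₗ[ℝ] Y :=
    LinearEquiv.ofFinrankEq _ _ (by simp)
  refine ⟨Module.finrank ℝ Y, (colSub V k).subtype ∘ₗ (g.trans e.symm).toLinearMap, ?_, ?_, ?_⟩
  · exact Subtype.val_injective.comp (g.trans e.symm).injective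
  · intro w
    constructor
    · intro hw
      exact ⟨(g.trans e.symm).symm ⟨w, hw⟩, by simp⟩
    · rintro ⟨u, rfl⟩
      exact ((g.trans e.symm) u).2
  · intro T hT
    let m : colSub V k →ₗ[ℝ] colSub V k :=
      (LinearMap.mulLeft ℝ T).restrict fun u hu => colSub_mul hV1 hT hu
    let f : Y →ₗ[ℝ] Y := e.toLinearMap ∘ₗ m ∘ₗ e.symm.toLinearMap
    refine ⟨g.symm.toLinearMap ∘ₗ f ∘ₗ g.toLinearMap, fun u => ?_, ?_⟩
    · simp only [f, m, LinearMap.comp_apply, LinearEquiv.coe_coe, LinearEquiv.trans_apply,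
        LinearEquiv.apply_symm_apply, LinearEquiv.symm_apply_apply]
      rfl
    · have hconj : LinearMap.det (g.symm.toLinearMap ∘ₗ f ∘ₗ g.toLinearMap) = LinearMap.det f :=
        LinearMap.det_conj f g.symm
      have hsingle : ∀ (j : {l : Fin (r + 1) // k < l}) (v : V j.1 k) l,
          (f (Pi.single j v) l : Matrix (Fin (n l.1)) (Fin (n k)) ℝ) = blk T l.1 j.1 * v.1 := by
        intro j v l
        have h1 : (f (Pi.single j v) l : Matrix (Fin (n l.1)) (Fin (n k)) ℝ)
            = blk (T * (e.symm (Pi.single j v)).1) l.1 k := rfl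
        have h2 : ∀ i : {l : Fin (r + 1) // k < l}, blk (e.symm (Pi.single j v)).1 i.1 k
            = ((Pi.single j v : Y) i).1 := by
          intro i
          have := congrFun (e.apply_symm_apply (Pi.single j v)) i
          exact congrArg Subtype.val this
        rw [h1, blk_mul, Finset.sum_eq_single j.1, h2 j, Pi.single_eq_same]
        · intro i _ hi
          by_cases hki : k < i
          · rw [h2 ⟨i, hki⟩, Pi.single_eq_of_ne (fun h => hi (congrArg Subtype.val h))]
            simp
          · rw [(mem_colSub_iff.1 (e.symm (Pi.single j v)).2).1 i k (Or.inr (not_lt.1 hki)),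
              Matrix.mul_zero]
        · simp
      rw [hconj, det_of_triangular f (fun l => tdiag T l.1)]
      · unfold colJac colDim
        have := Finset.prod_subtype (Finset.univ.filter fun l => k < l) (p := fun l => k < l)
          (F := inferInstance)
          (by simp) (fun l => tdiag T l ^ Module.finrank ℝ (V l k))
        rw [← this, Finset.prod_filter]
        refine Finset.prod_congr rfl fun l _ => ?_
        split_ifs <;> simp
      · intro j v l h
        refine Subtype.ext ((hsingle j v l).trans ?_)
        rw [hT.1 j.1 l.1 h, Matrix.zero_mul]
        rfl
      · intro j v
        refine Subtype.ext ((hsingle j v j).trans ?_)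
        rw [blk_diag hT, Matrix.smul_mul, Matrix.one_mul]
        rfl

end Coordinates

section Laplace

instance {m k : Type*} [Countable m] [Countable k] : BorelSpace (Matrix m k ℝ) :=
  inferInstanceAs (BorelSpace (m → k → ℝ))

instance {m k : Type*} [Countable m] [Countable k] : PolishSpace (Matrix m k ℝ) :=
  inferInstanceAs (PolishSpace (m → k → ℝ))

variable {V : ∀ l k : Fin (r + 1), Submodule ℝ (Matrix (Fin (n l)) (Fin (n k)) ℝ)}

/-- The Laplace transform of `μ` at the point `ρ*(T) I`. -/
noncomputable def lapH (μ : Measure (Mat r n)) (T : Mat r n) : ℝ≥0∞ :=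
  ∫⁻ x, ENNReal.ofReal (Real.exp (-(T * x * Tᵀ).trace)) ∂μ

theorem measurable_ofReal_exp_neg {f : Mat r n → ℝ} (hf : Continuous f) :
    Measurable fun x => ENNReal.ofReal (Real.exp (-f x)) :=
  (ENNReal.continuous_ofReal.comp (Real.continuous_exp.comp hf.neg)).measurable

theorem continuous_trace_rhoM (T : Mat r n) :
    Continuous fun x : Mat r n => (T * x * Tᵀ).trace := by
  fun_prop

theorem measurableSet_psdCone : MeasurableSet (psdCone V) := isClosed_psdCone.measurableSet

theorem chi_mul {S T : Mat r n} (hS : S ∈ Hgrp V) (hT : T ∈ Hgrp V) (s : Fin (r + 1) → ℝ) :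
    chi s (S * T) = chi s S * chi s T := by
  rw [mem_Hgrp_iff] at hS hT
  unfold chi
  rw [← Finset.prod_mul_distrib]
  refine Finset.prod_congr rfl fun k _ => ?_
  rw [tdiag_mul hS.1 hT.1, Real.mul_rpow (hS.2 k).le (hT.2 k).le]

theorem chi_pos {T : Mat r n} (hT : T ∈ Hgrp V) (s : Fin (r + 1) → ℝ) : 0 < chi s T :=
  Finset.prod_pos fun k _ => Real.rpow_pos_of_pos ((mem_Hgrp_iff.1 hT).2 k) _

theorem smul_mem_Hgrp {T : Mat r n} (hT : T ∈ Hgrp V) {a : ℝ} (ha : 0 < a) : a • T ∈ Hgrp V := by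
  rw [mem_Hgrp_iff] at *
  exact ⟨Submodule.smul_mem _ _ hT.1, fun k => by
    rw [tdiag_smul]; exact mul_pos ha (hT.2 k)⟩

theorem chi_sqrt_smul {T : Mat r n} (hT : T ∈ Hgrp V) (s : Fin (r + 1) → ℝ) {b : ℝ}
    (hb : 0 < b) : chi s (Real.sqrt b • T) = b ^ (∑ k, s k) * chi s T := by
  unfold chi
  rw [Real.rpow_sum_of_pos hb, ← Finset.prod_mul_distrib]
  refine Finset.prod_congr rfl fun k _ => ?_
  rw [tdiag_smul, Real.mul_rpow (Real.sqrt_nonneg b) ((mem_Hgrp_iff.1 hT).2 k).le,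
    Real.sqrt_eq_rpow, ← Real.rpow_mul hb.le]
  congr 2
  ring

theorem trace_smul_rhoM (a : ℝ) (T x : Mat r n) :
    ((a • T) * x * (a • T)ᵀ).trace = a * a * (T * x * Tᵀ).trace := by
  simp [Matrix.transpose_smul, smul_smul, Matrix.trace_smul]

/-- The quadratic form `x ↦ vᵀ x v` as a linear functional of `x`. -/
def quadL (v : Idx r n → ℝ) : Mat r n →ₗ[ℝ] ℝ where
  toFun x := v ⬝ᵥ (x *ᵥ v)
  map_add' x y := by rw [Matrix.add_mulVec, dotProduct_add]
  map_smul' c x := by rw [Matrix.smul_mulVec, dotProduct_smul]; rfl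

theorem quadL_nonneg {x : Mat r n} (hx : x ∈ psdCone V) (v : Idx r n → ℝ) : 0 ≤ quadL v x :=
  (posSemidef_iff_quad hx.1).1 hx.2 v

theorem eq_of_quadL {x y : Mat r n} (hx : x ∈ psdCone V) (hy : y ∈ psdCone V)
    (h : ∀ v, quadL v x = quadL v y) : x = y := by
  have hq : ∀ v, quadL v (x - y) = 0 := fun v => by rw [map_sub, h v, sub_self]
  have hd : (x - y).PosSemidef := by
    rw [posSemidef_iff_quad (Submodule.sub_mem _ hx.1 hy.1)]
    exact fun v => (hq v).ge
  have ht : (x - y).trace = 0 := by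
    refine Finset.sum_eq_zero fun p _ => ?_
    have := hq (Pi.single p 1)
    simpa [quadL] using this
  exact sub_eq_zero.1 (hd.trace_eq_zero_iff.1 ht)

theorem lintegral_comap_psdCone {μ : Measure (Mat r n)} (hμ : μ (psdCone V)ᶜ = 0)
    (g : Mat r n → ℝ≥0∞) :
    ∫⁻ x : psdCone V, g x ∂(μ.comap Subtype.val) = ∫⁻ x, g x ∂μ := by
  have he := MeasurableEmbedding.subtype_coe (measurableSet_psdCone (V := V))
  rw [← he.lintegral_map, he.map_comap, Subtype.range_coe, Measure.restrict_eq_self_of_ae_mem]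
  exact hμ

theorem map_comap_psdCone {μ : Measure (Mat r n)} (hμ : μ (psdCone V)ᶜ = 0) :
    (μ.comap (Subtype.val : psdCone V → Mat r n)).map Subtype.val = μ := by
  have he := MeasurableEmbedding.subtype_coe (measurableSet_psdCone (V := V))
  rw [he.map_comap, Subtype.range_coe, Measure.restrict_eq_self_of_ae_mem]
  exact hμ

/-- Linear functionals that are nonnegative on the cone. -/
def nonnegDual (V : ∀ l k : Fin (r + 1), Submodule ℝ (Matrix (Fin (n l)) (Fin (n k)) ℝ)) :
    Set (Mat r n →ₗ[ℝ] ℝ) := {f | ∀ x ∈ psdCone V, 0 ≤ f x}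

/-- The exponentials `x ↦ e^{-f(x)}` with `f` nonnegative on the cone. -/
def expMonoid (V : ∀ l k : Fin (r + 1), Submodule ℝ (Matrix (Fin (n l)) (Fin (n k)) ℝ)) :
    Submonoid (BoundedContinuousFunction (psdCone V) ℝ) where
  carrier := {g | ∃ f ∈ nonnegDual V, ∀ x, g x = Real.exp (-f x)}
  one_mem' := ⟨0, fun _ _ => le_rfl, fun x => by simp⟩
  mul_mem' := by
    rintro g g' ⟨f, hf, h⟩ ⟨f', hf', h'⟩
    exact ⟨f + f', fun x hx => add_nonneg (hf x hx) (hf' x hx), fun x => by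
      simp [h, h', ← Real.exp_add, add_comm]⟩

/-- The algebra spanned by the exponentials. -/
noncomputable def expAlg
    (V : ∀ l k : Fin (r + 1), Submodule ℝ (Matrix (Fin (n l)) (Fin (n k)) ℝ)) :
    StarSubalgebra ℝ (BoundedContinuousFunction (psdCone V) ℝ) :=
  { Algebra.adjoin ℝ (expMonoid V : Set (BoundedContinuousFunction (psdCone V) ℝ)) with
    star_mem' := by
      intro g hg
      have : star g = g := by
        ext x
        simp
      rw [this]
      exact hg }

theorem exists_mem_expMonoid {f : Mat r n →ₗ[ℝ] ℝ} (hf : f ∈ nonnegDual V) :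
    ∃ g ∈ expMonoid V, ∀ x, g x = Real.exp (-f x) := by
  have hc : Continuous fun x : psdCone V => Real.exp (-f x) :=
    Real.continuous_exp.comp
      ((LinearMap.continuous_of_finiteDimensional f).comp continuous_subtype_val).neg
  refine ⟨BoundedContinuousFunction.ofNormedAddCommGroup _ hc 1 fun x => ?_,
    ⟨f, hf, fun x => rfl⟩, fun x => rfl⟩
  rw [Real.norm_of_nonneg (Real.exp_pos _).le, Real.exp_le_one_iff]
  linarith [hf x x.2]

theorem mem_expAlg_iff {g : BoundedContinuousFunction (psdCone V) ℝ} : g ∈ expAlg V ↔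
    g ∈ Submodule.span ℝ (expMonoid V : Set (BoundedContinuousFunction (psdCone V) ℝ)) := by
  have h : g ∈ expAlg V ↔ g ∈ Subalgebra.toSubmodule (Algebra.adjoin ℝ
    (expMonoid V : Set (BoundedContinuousFunction (psdCone V) ℝ))) := Iff.rfl
  rw [h, Algebra.adjoin_eq_span, Submonoid.closure_eq]

theorem expAlg_separatesPoints :
    ((expAlg V).map (BoundedContinuousFunction.toContinuousMapStarₐ ℝ)).SeparatesPoints := by
  intro x y hxy
  have : ∃ v, quadL v (x : Mat r n) ≠ quadL v y := by
    by_contra! h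
    exact hxy (Subtype.ext (eq_of_quadL x.2 y.2 h))
  obtain ⟨v, hv⟩ := this
  obtain ⟨g, hg, hgx⟩ := exists_mem_expMonoid (V := V) (f := quadL v)
    fun x hx => quadL_nonneg hx v
  refine ⟨g, ⟨BoundedContinuousFunction.toContinuousMapStarₐ ℝ g,
    ⟨g, Algebra.subset_adjoin hg, rfl⟩, rfl⟩, ?_⟩
  rw [hgx, hgx]
  intro h
  exact hv (neg_injective (Real.exp_injective h))

theorem ext_of_lapH (hV1 : CondV1 V) (hV2 : CondV2 V) (hV3 : CondV3 V) {μ ν : Measure (Mat r n)}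
    (hμ : μ (psdCone V)ᶜ = 0) (hν : ν (psdCone V)ᶜ = 0) (hfin : lapH μ 1 ≠ ∞)
    (h : ∀ T ∈ Hgrp V, lapH μ T = lapH ν T) : μ = ν := by
  let w : psdCone V → ℝ≥0∞ := fun x => ENNReal.ofReal (Real.exp (-(x : Mat r n).trace))
  have hct : Continuous fun x : Mat r n => x.trace := by fun_prop
  have hw : Measurable w := (measurable_ofReal_exp_neg hct).comp measurable_subtype_coe
  let P : Measure (Mat r n) → Measure (psdCone V) :=
    fun m => (m.comap Subtype.val).withDensity w
  have hPf : ∀ m : Measure (Mat r n), m (psdCone V)ᶜ = 0 → lapH m 1 ≠ ∞ →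
      IsFiniteMeasure (P m) := by
    intro m hm hfin
    refine isFiniteMeasure_withDensity ?_
    have := lintegral_comap_psdCone hm fun x => ENNReal.ofReal (Real.exp (-x.trace))
    rw [this]
    simpa [lapH] using hfin
  have hPμ := hPf μ hμ hfin
  have hPν := hPf ν hν (by rwa [← h 1 one_mem_Hgrp])
  have hdual : ∀ (m : Measure (Mat r n)), m (psdCone V)ᶜ = 0 → ∀ f ∈ nonnegDual V,
      ∀ T, (∀ x ∈ Zsub V, x.trace + f x = (T * x * Tᵀ).trace) →
      ∫ x : psdCone V, Real.exp (-f x) ∂(P m) = (lapH m T).toReal := by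
    intro m hm f hf T hT
    have hcf := LinearMap.continuous_of_finiteDimensional f
    have hc : Continuous fun x : psdCone V => Real.exp (-f x) :=
      Real.continuous_exp.comp (hcf.comp continuous_subtype_val).neg
    rw [integral_eq_lintegral_of_nonneg_ae (Filter.Eventually.of_forall fun x =>
      (Real.exp_pos _).le) hc.aestronglyMeasurable]
    congr 1
    have hmf : Measurable fun x : psdCone V => ENNReal.ofReal (Real.exp (-f x)) :=
      (measurable_ofReal_exp_neg hcf).comp measurable_subtype_coe
    rw [lintegral_withDensity_eq_lintegral_mul _ hw hmf, lapH, ← lintegral_comap_psdCone hm]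
    refine lintegral_congr fun x => ?_
    simp only [w, Pi.mul_apply]
    rw [← ENNReal.ofReal_mul (Real.exp_pos _).le, ← Real.exp_add, ← hT x x.2.1]
    congr 2
    ring
  have heq : P μ = P ν := by
    have : PolishSpace (psdCone V) := isClosed_psdCone.polishSpace
    refine ext_of_forall_mem_subalgebra_integral_eq_of_polish (𝕜 := ℝ) (A := expAlg V)
      expAlg_separatesPoints ?_
    intro g hg
    replace hg := mem_expAlg_iff.1 hg
    induction hg using Submodule.span_induction with
    | mem g hg =>
      obtain ⟨f, hf, hgf⟩ := hg
      obtain ⟨T, hT, hTf⟩ := exists_Hgrp_of_pos hV1 hV2 hV3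
        (Matrix.traceLinearMap (Idx r n) ℝ ℝ + f) fun x hx h0 =>
          add_pos_of_pos_of_nonneg (trace_pos_of_mem hx h0) (hf x hx)
      simp only [hgf]
      rw [hdual μ hμ f hf T hTf, hdual ν hν f hf T hTf, h T hT]
    | zero => simp
    | add a b ha hb iha ihb =>
      simp only [BoundedContinuousFunction.coe_add, Pi.add_apply]
      rw [integral_add (a.integrable _) (b.integrable _),
        integral_add (a.integrable _) (b.integrable _), iha, ihb]
    | smul c a ha iha =>
      simp only [BoundedContinuousFunction.coe_smul, smul_eq_mul]
      rw [integral_const_mul, integral_const_mul, iha]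
  have hcomap : ∀ m : Measure (Mat r n),
      (P m).withDensity w⁻¹ = m.comap (Subtype.val : psdCone V → Mat r n) := fun m =>
    withDensity_inv_same hw (Filter.Eventually.of_forall fun x =>
      (ENNReal.ofReal_pos.2 (Real.exp_pos _)).ne')
      (Filter.Eventually.of_forall fun x => ENNReal.ofReal_ne_top)
  rw [← map_comap_psdCone hμ, ← map_comap_psdCone hν, ← hcomap μ, ← hcomap ν, heq]

end Laplace

section Support

variable {V : ∀ l k : Fin (r + 1), Submodule ℝ (Matrix (Fin (n l)) (Fin (n k)) ℝ)}

theorem ae_nonneg_of_lintegral_exp_le {α : Type*} [MeasurableSpace α] {μ : Measure α} {f : α → ℝ}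
    (hf : Measurable f) {C p : ℝ}
    (h : ∀ b : ℝ, 0 < b →
      ∫⁻ x, ENNReal.ofReal (Real.exp (-(b * f x))) ∂μ ≤ ENNReal.ofReal (b ^ p * C)) :
    ∀ᵐ x ∂μ, 0 ≤ f x := by
  have key : ∀ c : ℝ, 0 < c → μ {x | f x ≤ -c} = 0 := by
    intro c hc
    have hb : ∀ b : ℝ, 0 < b →
        μ {x | f x ≤ -c} ≤ ENNReal.ofReal (b ^ p * Real.exp (-c * b) * C) := by
      intro b hb
      have h1 : ENNReal.ofReal (Real.exp (c * b)) * μ {x | f x ≤ -c} ≤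
          ENNReal.ofReal (b ^ p * C) := by
        refine le_trans (le_trans (mul_le_mul_right (measure_mono fun x hx => ?_) _)
          (mul_meas_ge_le_lintegral ?_ (ENNReal.ofReal (Real.exp (c * b))))) (h b hb)
        · refine ENNReal.ofReal_le_ofReal (Real.exp_le_exp.2 ?_)
          have hx' : f x ≤ -c := hx
          nlinarith
        · exact (Real.measurable_exp.comp (hf.const_mul b).neg).ennreal_ofReal
      have h2 : ENNReal.ofReal (Real.exp (-c * b)) * ENNReal.ofReal (Real.exp (c * b)) = 1 := by
        rw [← ENNReal.ofReal_mul (Real.exp_pos _).le, ← Real.exp_add]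
        simp
      calc μ {x | f x ≤ -c}
          = ENNReal.ofReal (Real.exp (-c * b)) *
            (ENNReal.ofReal (Real.exp (c * b)) * μ {x | f x ≤ -c}) := by
            rw [← mul_assoc, h2, one_mul]
        _ ≤ ENNReal.ofReal (Real.exp (-c * b)) * ENNReal.ofReal (b ^ p * C) := by gcongr
        _ = _ := by
            rw [← ENNReal.ofReal_mul (Real.exp_pos _).le]
            congr 1
            ring
    have ht := ((tendsto_rpow_mul_exp_neg_mul_atTop_nhds_zero p c hc).mul_const C)
    rw [zero_mul] at ht
    have ht' := ENNReal.tendsto_ofReal ht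
    rw [ENNReal.ofReal_zero] at ht'
    refine le_antisymm (ge_of_tendsto ht' ?_) bot_le
    filter_upwards [Filter.eventually_gt_atTop 0] with b hb' using hb b hb'
  have hall : ∀ᵐ x ∂μ, ∀ j : ℕ, -(1 / ((j : ℝ) + 1)) < f x := by
    rw [ae_all_iff]
    intro j
    have := key (1 / ((j : ℝ) + 1)) Nat.one_div_pos_of_nat
    rw [ae_iff]
    simpa only [not_lt] using this
  filter_upwards [hall] with x hx
  by_contra! hneg
  obtain ⟨j, hj⟩ := exists_nat_one_div_lt (neg_pos.2 hneg)
  linarith [hx j]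

theorem ae_trace_rhoM_nonneg {μ : Measure (Mat r n)} {s : Fin (r + 1) → ℝ}
    (h : ∀ T ∈ Hgrp V, lapH μ T = ENNReal.ofReal (chi s T)) {T : Mat r n} (hT : T ∈ Hgrp V) :
    ∀ᵐ x ∂μ, 0 ≤ (T * x * Tᵀ).trace := by
  refine ae_nonneg_of_lintegral_exp_le (C := chi s T) (p := ∑ k, s k)
    (continuous_trace_rhoM T).measurable fun b hb => ?_
  rw [← chi_sqrt_smul hT s hb, ← h _ (smul_mem_Hgrp hT (Real.sqrt_pos.2 hb))]
  refine (lintegral_congr fun x => ?_).le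
  rw [trace_smul_rhoM, Real.mul_self_sqrt hb.le]

theorem measure_compl_psdCone_eq_zero (hV1 : CondV1 V) (hV2 : CondV2 V) (hV3 : CondV3 V)
    {μ : Measure (Mat r n)} {s : Fin (r + 1) → ℝ} (hZ : μ (Zspace V)ᶜ = 0)
    (h : ∀ T ∈ Hgrp V, lapH μ T = ENNReal.ofReal (chi s T)) : μ (psdCone V)ᶜ = 0 := by
  have hq : ∀ (v : Idx r n → ℝ) (m : ℕ),
      ∀ᵐ x ∂μ, 0 ≤ quadL v x + 1 / ((m : ℝ) + 1) * x.trace := by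
    intro v m
    obtain ⟨T, hT, hTf⟩ := exists_Hgrp_of_pos hV1 hV2 hV3
      (quadL v + (1 / ((m : ℝ) + 1)) • Matrix.traceLinearMap (Idx r n) ℝ ℝ) fun x hx h0 =>
        add_pos_of_nonneg_of_pos (quadL_nonneg hx v)
          (mul_pos Nat.one_div_pos_of_nat (trace_pos_of_mem hx h0))
    filter_upwards [ae_trace_rhoM_nonneg h hT, measure_eq_zero_iff_ae_notMem.1 hZ] with x hx hxZ
    rw [← hTf x (mem_Zspace_iff.1 (not_not.1 hxZ))] at hx
    exact hx
  have hall : ∀ᵐ x ∂μ, ∀ (i m : ℕ),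
      0 ≤ quadL (TopologicalSpace.denseSeq (Idx r n → ℝ) i) x + 1 / ((m : ℝ) + 1) * x.trace := by
    rw [ae_all_iff]
    intro i
    rw [ae_all_iff]
    exact fun m => hq _ m
  rw [measure_eq_zero_iff_ae_notMem]
  filter_upwards [hall, measure_eq_zero_iff_ae_notMem.1 hZ] with x hx hxZ
  have hxZ' := mem_Zspace_iff.1 (not_not.1 hxZ)
  rw [Set.mem_compl_iff, not_not]
  refine ⟨hxZ', (posSemidef_iff_quad hxZ').2 ?_⟩
  have hd : ∀ i, 0 ≤ quadL (TopologicalSpace.denseSeq (Idx r n → ℝ) i) x := by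
    intro i
    have ht : Filter.Tendsto (fun m : ℕ => quadL (TopologicalSpace.denseSeq (Idx r n → ℝ) i) x +
        1 / ((m : ℝ) + 1) * x.trace) Filter.atTop
        (nhds (quadL (TopologicalSpace.denseSeq (Idx r n → ℝ) i) x + 0 * x.trace)) :=
      (tendsto_one_div_add_atTop_nhds_zero_nat.mul_const _).const_add _
    rw [zero_mul, add_zero] at ht
    exact ge_of_tendsto' ht (hx i)
  have hclosed : IsClosed {v : Idx r n → ℝ | 0 ≤ v ⬝ᵥ (x *ᵥ v)} :=
    isClosed_le continuous_const (by fun_prop)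
  have hdense := TopologicalSpace.denseRange_denseSeq (Idx r n → ℝ)
  intro v
  have : closure (Set.range (TopologicalSpace.denseSeq (Idx r n → ℝ))) ⊆
      {v : Idx r n → ℝ | 0 ≤ v ⬝ᵥ (x *ᵥ v)} := by
    refine closure_minimal ?_ hclosed
    rintro _ ⟨i, rfl⟩
    exact hd i
  exact this (hdense v)

end Support

section Existence

variable {V : ∀ l k : Fin (r + 1), Submodule ℝ (Matrix (Fin (n l)) (Fin (n k)) ℝ)}

theorem exists_le_trace_mul_transpose {E : Type*} [NormedAddCommGroup E] [NormedSpace ℝ E]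
    [FiniteDimensional ℝ E] (J : E →ₗ[ℝ] Mat r n) (hJ : Function.Injective J) :
    ∃ c : ℝ, 0 < c ∧ ∀ u, c * ‖u‖ ^ 2 ≤ (J u * (J u)ᵀ).trace := by
  have hJc : Continuous J := LinearMap.continuous_of_finiteDimensional J
  have hcont : Continuous fun u => (J u * (J u)ᵀ).trace := by fun_prop
  have hpos : ∀ u, u ≠ 0 → 0 < (J u * (J u)ᵀ).trace := fun u hu =>
    lt_of_le_of_ne (trace_mul_transpose_self_nonneg _) fun h =>
      hu (hJ ((trace_mul_transpose_self_eq_zero h.symm).trans (map_zero J).symm))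
  have hsph : ∃ c : ℝ, 0 < c ∧ ∀ u ∈ Metric.sphere (0 : E) 1, c ≤ (J u * (J u)ᵀ).trace := by
    by_cases hne : (Metric.sphere (0 : E) 1).Nonempty
    · obtain ⟨u₀, hu₀, hmin⟩ := (isCompact_sphere (0 : E) 1).exists_isMinOn hne
        hcont.continuousOn
      exact ⟨_, hpos u₀ (ne_zero_of_mem_unit_sphere ⟨u₀, hu₀⟩), fun u hu => hmin hu⟩
    · exact ⟨1, one_pos, fun u hu => (hne ⟨u, hu⟩).elim⟩
  obtain ⟨c, hc, h⟩ := hsph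
  refine ⟨c, hc, fun u => ?_⟩
  by_cases hu : u = 0
  · simp [hu]
  have hn : ‖u‖ ≠ 0 := norm_ne_zero_iff.2 hu
  have h1 := h (‖u‖⁻¹ • u) (by simp [norm_smul, hn])
  have h2 : (J (‖u‖⁻¹ • u) * (J (‖u‖⁻¹ • u))ᵀ).trace
      = (‖u‖ ^ 2)⁻¹ * (J u * (J u)ᵀ).trace := by
    rw [map_smul, Matrix.transpose_smul, Matrix.smul_mul, Matrix.mul_smul, smul_smul,
      Matrix.trace_smul, smul_eq_mul, sq, mul_inv]
  rw [h2, inv_mul_eq_div, le_div_iff₀ (by positivity)] at h1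
  exact h1

/-- The Gaussian integral in the coordinates of a block column. -/
noncomputable def gaussInt {d : ℕ} (J : EuclideanSpace ℝ (Fin d) →ₗ[ℝ] Mat r n) : ℝ≥0∞ :=
  ∫⁻ u, ENNReal.ofReal (Real.exp (-(J u * (J u)ᵀ).trace))

theorem measurable_gauss {d : ℕ} (J : EuclideanSpace ℝ (Fin d) →ₗ[ℝ] Mat r n) :
    Measurable fun u => ENNReal.ofReal (Real.exp (-(J u * (J u)ᵀ).trace)) := by
  have hJc : Continuous J := LinearMap.continuous_of_finiteDimensional J
  have hcont : Continuous fun u => (J u * (J u)ᵀ).trace := by fun_prop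
  exact (ENNReal.continuous_ofReal.comp (Real.continuous_exp.comp hcont.neg)).measurable

theorem gaussInt_ne_top {d : ℕ} {J : EuclideanSpace ℝ (Fin d) →ₗ[ℝ] Mat r n}
    (hJ : Function.Injective J) : gaussInt J ≠ ∞ := by
  obtain ⟨c, hc, h⟩ := exists_le_trace_mul_transpose J hJ
  have hexp : Integrable fun v : EuclideanSpace ℝ (Fin d) => Real.exp (-c * ‖v‖ ^ 2) := by
    by_contra hni
    have h1 := GaussianFourier.integral_rexp_neg_mul_sq_norm (V := EuclideanSpace ℝ (Fin d)) hc
    rw [integral_undef hni] at h1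
    exact (Real.rpow_pos_of_pos (div_pos Real.pi_pos hc) _).ne h1
  refine ((lintegral_mono fun v => ENNReal.ofReal_le_ofReal (Real.exp_le_exp.2 ?_)).trans_lt
    hexp.lintegral_lt_top).ne
  linarith [h v]

theorem gaussInt_ne_zero {d : ℕ} (J : EuclideanSpace ℝ (Fin d) →ₗ[ℝ] Mat r n) :
    gaussInt J ≠ 0 := by
  unfold gaussInt
  rw [Ne, lintegral_eq_zero_iff (measurable_gauss J)]
  intro h
  have h' : ∀ᵐ u : EuclideanSpace ℝ (Fin d), False := by
    filter_upwards [h] with u hu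
    exact (ENNReal.ofReal_pos.2 (Real.exp_pos _)).ne' hu
  rw [Filter.eventually_false_iff_eq_bot, ae_eq_bot] at h'
  exact NeZero.ne _ h'

theorem lintegral_comp_linear_add {E : Type*} [NormedAddCommGroup E] [NormedSpace ℝ E]
    [FiniteDimensional ℝ E] [MeasurableSpace E] [BorelSpace E] (m : Measure E) [m.IsAddHaarMeasure]
    (φ : E →ₗ[ℝ] E) (hφ : 0 < LinearMap.det φ) (c : E) {g : E → ℝ≥0∞} (hg : Measurable g) :
    ∫⁻ u, g (c + φ u) ∂m = ENNReal.ofReal (LinearMap.det φ)⁻¹ * ∫⁻ u, g u ∂m := by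
  have hm : Measurable φ := (LinearMap.continuous_of_finiteDimensional φ).measurable
  have h1 : ∫⁻ u, g (c + φ u) ∂m = ∫⁻ u, g (c + u) ∂(m.map φ) :=
    (lintegral_map (hg.comp (measurable_const_add c)) hm).symm
  rw [h1, Measure.map_linearMap_addHaar_eq_smul_addHaar m hφ.ne', lintegral_smul_measure,
    lintegral_add_left_eq_self g c, abs_of_pos (inv_pos.2 hφ), smul_eq_mul]

theorem lintegral_radial {α A : ℝ} (hα : 0 < α) (hA : 0 < A) :
    ∫⁻ a in Set.Ioi (0 : ℝ),
      ENNReal.ofReal (a ^ (2 * α - 1)) * ENNReal.ofReal (Real.exp (-(A * a ^ 2))) =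
      ENNReal.ofReal (Real.Gamma α / 2 * A ^ (-α)) := by
  have h1 := integral_rpow_mul_exp_neg_mul_rpow (p := 2) (q := 2 * α - 1) two_pos
    (by linarith) hA
  have h2 := integrableOn_rpow_mul_exp_neg_mul_rpow (p := 2) (s := 2 * α - 1) (by linarith)
    two_pos hA
  have h3 : ∫⁻ a in Set.Ioi (0 : ℝ),
      ENNReal.ofReal (a ^ (2 * α - 1)) * ENNReal.ofReal (Real.exp (-(A * a ^ 2))) =
      ∫⁻ a in Set.Ioi (0 : ℝ), ENNReal.ofReal (a ^ (2 * α - 1) * Real.exp (-A * a ^ (2 : ℝ))) := by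
    refine setLIntegral_congr_fun measurableSet_Ioi fun a ha => ?_
    rw [← ENNReal.ofReal_mul (Real.rpow_nonneg (le_of_lt ha) _), Real.rpow_two, neg_mul]
  rw [h3, ← ofReal_integral_eq_lintegral_ofReal h2, h1]
  · congr 1
    rw [show -(2 * α - 1 + 1) / 2 = -α by ring, show (2 * α - 1 + 1) / 2 = α by ring]
    ring
  · filter_upwards [ae_restrict_mem measurableSet_Ioi] with a ha
    exact mul_nonneg (Real.rpow_nonneg (le_of_lt ha) _) (Real.exp_pos _).le

theorem mul_blkProj_sub_mem {T : Mat r n} (hT : T ∈ lowAlg V) (k : Fin (r + 1)) :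
    T * blkProj k - tdiag T k • (blkProj k : Mat r n) ∈ colSub V k := by
  have hbl : ∀ l q, blk (T * blkProj k : Mat r n) l q = if q = k then blk T l q else 0 := by
    intro l q
    ext a b
    rw [blk_apply, mul_blkProj_apply]
    split_ifs with h <;> simp_all [blk_apply]
  have hE : ∀ l q, blk (blkProj k : Mat r n) l q = if l = k ∧ l = q then blk 1 l q else 0 := by
    intro l q
    ext a b
    simp only [blk_apply, blkProj, Matrix.diagonal_apply]
    by_cases h1 : l = q
    · subst h1
      by_cases h2 : l = k
      · simp [h2, blk_apply, Matrix.one_apply]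
      · simp [h2]
    · simp [h1]
  have hsub : ∀ l q, blk (T * blkProj k - tdiag T k • (blkProj k : Mat r n)) l q
      = blk (T * blkProj k : Mat r n) l q - tdiag T k • blk (blkProj k : Mat r n) l q :=
    fun _ _ => rfl
  rw [mem_colSub_iff]
  refine ⟨fun l q h => ?_, fun l h => ?_⟩
  · rw [hsub, hbl, hE]
    by_cases hq : q = k
    · subst hq
      have hl : l ≤ q := h.resolve_left (fun h => h rfl)
      rcases hl.lt_or_eq with hl | rfl
      · simp [hl.ne, hT.1 q l hl]
      · have h1 : blk (1 : Mat r n) l l = 1 := by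
          ext a b
          simp [blk_apply, Matrix.one_apply]
        simp [blk_diag hT, h1]
    · rw [if_neg hq, if_neg (by rintro ⟨rfl, rfl⟩; exact hq rfl), smul_zero, sub_zero]
  · rw [hsub, hbl, hE, if_pos rfl, if_neg (by rintro ⟨rfl, -⟩; exact lt_irrefl _ h), smul_zero,
      sub_zero]
    exact hT.2.1 k l h

theorem trace_smul_blkProj_add {k : Fin (r + 1)} {w : Mat r n} (hw : w ∈ colSub V k) (a : ℝ) :
    ((a • blkProj k + w) * (a • blkProj k + w)ᵀ).trace = a ^ 2 * n k + (w * wᵀ).trace := by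
  have h1 : ((blkProj k : Mat r n) * wᵀ).trace = 0 := by
    rw [Matrix.trace_mul_comm, ← Matrix.trace_transpose, Matrix.transpose_mul,
      Matrix.transpose_transpose, blkProj_transpose, hw.2.2, Matrix.trace_zero]
  have h2 : (w * (blkProj k : Mat r n)).trace = 0 := by
    rw [Matrix.trace_mul_comm, hw.2.2, Matrix.trace_zero]
  rw [Matrix.transpose_add, Matrix.transpose_smul, blkProj_transpose, Matrix.add_mul,
    Matrix.mul_add, Matrix.mul_add]
  simp only [Matrix.smul_mul, Matrix.mul_smul, smul_smul, blkProj_mul_self, Matrix.trace_add,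
    Matrix.trace_smul, h1, h2, trace_blkProj, smul_eq_mul]
  ring

theorem colJac_pos {T : Mat r n} (hT : T ∈ Hgrp V) (k : Fin (r + 1)) : 0 < colJac V k T :=
  Finset.prod_pos fun l _ => pow_pos ((mem_Hgrp_iff.1 hT).2 l) _

theorem exists_column_measure (hV1 : CondV1 V) (hV2 : CondV2 V) (hV3 : CondV3 V)
    (k : Fin (r + 1)) {α : ℝ} (hα : 0 < α) :
    ∃ μ : Measure (Mat r n), SFinite μ ∧ μ (psdCone V)ᶜ = 0 ∧ ∃ C : ℝ, 0 < C ∧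
      ∀ T ∈ Hgrp V, lapH μ T =
        ENNReal.ofReal (C * (tdiag T k ^ (-(2 * α)) * (colJac V k T)⁻¹)) := by
  obtain ⟨d, J, hJ, hJm, hJφ⟩ := exists_coord hV1 k
  have hJc : Continuous J := LinearMap.continuous_of_finiteDimensional J
  have hJmem : ∀ u, J u ∈ colSub V k := fun u => (hJm _).2 ⟨u, rfl⟩
  let D : ℝ → ℝ≥0∞ := fun a => ENNReal.ofReal (a ^ (2 * α - 1))
  have hD : Measurable D := by fun_prop
  let m₁ : Measure ℝ := (volume.restrict (Set.Ioi 0)).withDensity D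
  let F : ℝ × EuclideanSpace ℝ (Fin d) → Mat r n := fun p =>
    (p.1 • blkProj k + J p.2) * (p.1 • blkProj k + J p.2)ᵀ
  have hFc : Continuous F := by fun_prop
  have hF : Measurable F := hFc.measurable
  refine ⟨(m₁.prod volume).map F, inferInstance, ?_,
    Real.Gamma α / 2 * (n k : ℝ) ^ (-α) * (gaussInt J).toReal, ?_, fun T hT => ?_⟩
  · rw [Measure.map_apply hF measurableSet_psdCone.compl]
    convert measure_empty (μ := m₁.prod volume)
    refine Set.eq_empty_of_forall_notMem fun p hp => hp ?_
    exact mul_transpose_self_mem_psdCone hV2 hV3 (Submodule.add_mem _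
      (Submodule.smul_mem _ _ (blkProj_mem_lowAlg k)) (hJmem p.2).1)
  · have hnk : (0 : ℝ) < n k := Nat.cast_pos.2 (n k).2
    exact mul_pos (mul_pos (half_pos (Real.Gamma_pos_of_pos hα)) (Real.rpow_pos_of_pos hnk _))
      (ENNReal.toReal_pos (gaussInt_ne_zero J) (gaussInt_ne_top hJ))
  have hT' := mem_Hgrp_iff.1 hT
  have hnk : (0 : ℝ) < n k := Nat.cast_pos.2 (n k).2
  have ht := hT'.2 k
  obtain ⟨φ, hφ, hdet⟩ := hJφ T hT'.1
  obtain ⟨u₀, hu₀⟩ := (hJm _).1 (mul_blkProj_sub_mem hT'.1 k)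
  have hTF : ∀ p, (T * F p * Tᵀ).trace = n k * tdiag T k ^ 2 * p.1 ^ 2 +
      (J (p.1 • u₀ + φ p.2) * (J (p.1 • u₀ + φ p.2))ᵀ).trace := by
    intro p
    have h1 : T * (p.1 • blkProj k + J p.2) =
        (p.1 * tdiag T k) • blkProj k + J (p.1 • u₀ + φ p.2) := by
      rw [map_add, map_smul, hu₀, hφ, Matrix.mul_add, Matrix.mul_smul, smul_sub, smul_smul]
      abel
    have h2 : T * F p * Tᵀ = (T * (p.1 • blkProj k + J p.2)) *
        (T * (p.1 • blkProj k + J p.2))ᵀ := by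
      simp only [F, Matrix.transpose_mul, Matrix.mul_assoc]
    rw [h2, h1, trace_smul_blkProj_add (hJmem _)]
    ring
  have hmeas : Measurable fun p => ENNReal.ofReal (Real.exp (-(T * F p * Tᵀ).trace)) :=
    (measurable_ofReal_exp_neg (continuous_trace_rhoM T)).comp hF
  have hcpos := colJac_pos hT k
  rw [lapH, lintegral_map (measurable_ofReal_exp_neg (continuous_trace_rhoM T)) hF,
    lintegral_prod _ hmeas.aemeasurable]
  have hinner : ∀ a : ℝ, ∫⁻ u, ENNReal.ofReal (Real.exp (-(T * F (a, u) * Tᵀ).trace)) =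
      ENNReal.ofReal (Real.exp (-(n k * tdiag T k ^ 2 * a ^ 2))) *
        (ENNReal.ofReal (colJac V k T)⁻¹ * gaussInt J) := by
    intro a
    have h1 : ∀ u, ENNReal.ofReal (Real.exp (-(T * F (a, u) * Tᵀ).trace)) =
        ENNReal.ofReal (Real.exp (-(n k * tdiag T k ^ 2 * a ^ 2))) *
        ENNReal.ofReal (Real.exp (-(J (a • u₀ + φ u) * (J (a • u₀ + φ u))ᵀ).trace)) := by
      intro u
      rw [← ENNReal.ofReal_mul (Real.exp_pos _).le, ← Real.exp_add, hTF]
      congr 2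
      ring
    simp only [h1]
    rw [lintegral_const_mul' _ _ ENNReal.ofReal_ne_top, lintegral_comp_linear_add volume φ
      (by rw [hdet]; exact hcpos) (a • u₀) (measurable_gauss J), hdet, gaussInt]
  simp only [hinner]
  rw [lintegral_mul_const' _ _
    (ENNReal.mul_ne_top ENNReal.ofReal_ne_top (gaussInt_ne_top hJ)),
    lintegral_withDensity_eq_lintegral_mul _ hD (by fun_prop)]
  simp only [Pi.mul_apply, D]
  rw [lintegral_radial hα (by positivity), ← ENNReal.ofReal_toReal (gaussInt_ne_top hJ),
    ← ENNReal.ofReal_mul (inv_pos.2 hcpos).le, ← ENNReal.ofReal_mul]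
  · congr 1
    rw [Real.mul_rpow hnk.le (by positivity), ← Real.rpow_natCast (tdiag T k) 2,
      ← Real.rpow_mul ht.le]
    rw [ENNReal.toReal_ofReal ENNReal.toReal_nonneg]
    rw [show ((2 : ℕ) : ℝ) * -α = -(2 * α) by push_cast; ring]
    ring
  · exact mul_nonneg (half_pos (Real.Gamma_pos_of_pos hα)).le (by positivity)

end Existence

section Sufficiency

variable {V : ∀ l k : Fin (r + 1), Submodule ℝ (Matrix (Fin (n l)) (Fin (n k)) ℝ)}

theorem exists_sum_measure (hV1 : CondV1 V) (hV2 : CondV2 V) (hV3 : CondV3 V)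
    (α : Fin (r + 1) → ℝ) (S : Finset (Fin (r + 1))) (hα : ∀ k ∈ S, 0 < α k) :
    ∃ μ : Measure (Mat r n), SFinite μ ∧ μ (psdCone V)ᶜ = 0 ∧ ∃ C : ℝ, 0 < C ∧
      ∀ T ∈ Hgrp V, lapH μ T =
        ENNReal.ofReal (C * ∏ k ∈ S, tdiag T k ^ (-(2 * α k)) * (colJac V k T)⁻¹) := by
  induction S using Finset.induction_on with
  | empty =>
    refine ⟨Measure.dirac 0, inferInstance, ?_, 1, one_pos, fun T _ => ?_⟩
    · rw [Measure.dirac_apply' _ measurableSet_psdCone.compl, Set.indicator_of_notMem]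
      exact fun h => h ⟨Submodule.zero_mem _, Matrix.PosSemidef.zero⟩
    · rw [lapH, lintegral_dirac' _ (measurable_ofReal_exp_neg (continuous_trace_rhoM T))]
      simp
  | insert k S hk ih =>
    obtain ⟨μ, hμs, hμ, C, hC, hL⟩ := ih fun j hj => hα j (Finset.mem_insert_of_mem hj)
    obtain ⟨ν, hνs, hν, D, hD, hL'⟩ :=
      exists_column_measure hV1 hV2 hV3 k (hα k (Finset.mem_insert_self k S))
    have hadd : Measurable fun p : Mat r n × Mat r n => p.1 + p.2 :=
      (continuous_fst.add continuous_snd).measurable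
    refine ⟨(ν.prod μ).map fun p => p.1 + p.2, inferInstance, ?_, D * C, mul_pos hD hC,
      fun T hT => ?_⟩
    · rw [Measure.map_apply hadd measurableSet_psdCone.compl, measure_eq_zero_iff_ae_notMem]
      have h1 : ∀ᵐ p ∂(ν.prod μ), p.1 ∈ psdCone V :=
        Measure.quasiMeasurePreserving_fst.ae (p := fun x => x ∈ psdCone V) hν
      have h2 : ∀ᵐ p ∂(ν.prod μ), p.2 ∈ psdCone V :=
        Measure.quasiMeasurePreserving_snd.ae (p := fun x => x ∈ psdCone V) hμ
      filter_upwards [h1, h2] with p hp1 hp2 h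
      exact h ⟨Submodule.add_mem _ hp1.1 hp2.1, hp1.2.add hp2.2⟩
    · have hm := measurable_ofReal_exp_neg (continuous_trace_rhoM T)
      have hsplit : ∀ x y : Mat r n,
          ENNReal.ofReal (Real.exp (-(T * (x + y) * Tᵀ).trace)) =
          ENNReal.ofReal (Real.exp (-(T * x * Tᵀ).trace)) *
          ENNReal.ofReal (Real.exp (-(T * y * Tᵀ).trace)) := by
        intro x y
        rw [← ENNReal.ofReal_mul (Real.exp_pos _).le, ← Real.exp_add, Matrix.mul_add,
          Matrix.add_mul, Matrix.trace_add, neg_add]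
      rw [lapH, lintegral_map hm hadd]
      simp only [hsplit]
      rw [lintegral_prod_mul hm.aemeasurable hm.aemeasurable]
      change lapH ν T * lapH μ T = _
      rw [hL T hT, hL' T hT, Finset.prod_insert hk, ← ENNReal.ofReal_mul]
      · congr 1
        ring
      · exact mul_nonneg hD.le (mul_nonneg (Real.rpow_nonneg ((mem_Hgrp_iff.1 hT).2 k).le _)
          (inv_nonneg.2 (colJac_pos hT k).le))

theorem sum_colDim (ε : Fin (r + 1) → Bool) (l : Fin (r + 1)) :
    ∑ k ∈ Finset.univ.filter (fun k => ε k = true), (colDim V k l : ℝ) = 2 * xiBound V ε l := by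
  unfold xiBound colDim
  rw [Finset.sum_filter, Finset.sum_filter, ← mul_assoc]
  norm_num
  refine Finset.sum_congr rfl fun k _ => ?_
  split_ifs <;> simp

theorem exists_measure_of_mem_XiSet (hV1 : CondV1 V) (hV2 : CondV2 V) (hV3 : CondV3 V)
    {s : Fin (r + 1) → ℝ} (hs : s ∈ XiSet V) :
    ∃ μ : Measure (Mat r n), μ (psdCone V)ᶜ = 0 ∧
      ∀ T ∈ Hgrp V, lapH μ T = ENNReal.ofReal (chi (-s) T) := by
  obtain ⟨ε, hε⟩ := Set.mem_iUnion.1 hs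
  obtain ⟨μ, -, hμ, C, hC, hL⟩ := exists_sum_measure hV1 hV2 hV3
    (fun k => s k - xiBound V ε k) (Finset.univ.filter fun k => ε k = true)
    fun k hk => sub_pos.2 ((hε k).1 (Finset.mem_filter.1 hk).2)
  refine ⟨ENNReal.ofReal C⁻¹ • μ, by simp [hμ], fun T hT => ?_⟩
  have hpos := (mem_Hgrp_iff.1 hT).2
  have hprod : ∏ k ∈ Finset.univ.filter (fun k => ε k = true),
      tdiag T k ^ (-(2 * (s k - xiBound V ε k))) * (colJac V k T)⁻¹ = chi (-s) T := by
    have h1 : ∏ k ∈ Finset.univ.filter (fun k => ε k = true), (colJac V k T)⁻¹ =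
        ∏ l, tdiag T l ^ (-(2 * xiBound V ε l)) := by
      unfold colJac
      simp only [← Finset.prod_inv_distrib]
      rw [Finset.prod_comm]
      refine Finset.prod_congr rfl fun l _ => ?_
      rw [← sum_colDim, ← Finset.sum_neg_distrib, Real.rpow_sum_of_pos (hpos l)]
      refine Finset.prod_congr rfl fun k _ => ?_
      rw [Real.rpow_neg (hpos l).le, Real.rpow_natCast]
    rw [Finset.prod_mul_distrib, h1, Finset.prod_filter, ← Finset.prod_mul_distrib]
    unfold chi
    refine Finset.prod_congr rfl fun k _ => ?_
    by_cases h : ε k = true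
    · rw [if_pos h, ← Real.rpow_add (hpos k)]
      congr 1
      simp only [Pi.neg_apply]
      ring
    · rw [if_neg h, one_mul, Pi.neg_apply, (hε k).2 (by simpa using h)]
      congr 1
      ring
  rw [lapH, lintegral_smul_measure, ← lapH, hL T hT, hprod, smul_eq_mul,
    ← ENNReal.ofReal_mul (inv_pos.2 hC).le, ← mul_assoc, inv_mul_cancel₀ hC.ne', one_mul]

end Sufficiency

section Decomposition

variable {V : ∀ l k : Fin (r + 1), Submodule ℝ (Matrix (Fin (n l)) (Fin (n k)) ℝ)}

/-- The `k`-th block column of `x`, normalized to have the identity as diagonal block. -/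
noncomputable def colW (k : Fin (r + 1)) (x : Mat r n) : Mat r n :=
  (tdiag x k)⁻¹ • (x * blkProj k)

/-- The Schur complement of the `k`-th diagonal block of `x`. -/
noncomputable def colY (k : Fin (r + 1)) (x : Mat r n) : Mat r n :=
  x - tdiag x k • (colW k x * (colW k x)ᵀ)

theorem blkProj_mul_colSub_transpose {k : Fin (r + 1)} {v : Mat r n} (hv : v ∈ colSub V k) :
    (blkProj k : Mat r n) * vᵀ = vᵀ := by
  rw [← blkProj_transpose, ← Matrix.transpose_mul, hv.2.1]

theorem colSub_transpose_mul_blkProj {k : Fin (r + 1)} {v : Mat r n} (hv : v ∈ colSub V k) :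
    vᵀ * (blkProj k : Mat r n) = 0 := by
  rw [← blkProj_transpose, ← Matrix.transpose_mul, hv.2.2, Matrix.transpose_zero]

theorem colW_sub_mem {k : Fin (r + 1)} {x : Mat r n} (hx : x ∈ Zsub V) (hs : SuppGE k x)
    (hc : tdiag x k ≠ 0) : colW k x - blkProj k ∈ colSub V k := by
  rw [colW, mul_blkProj_of_suppGE hx hs, smul_add, smul_smul, inv_mul_cancel₀ hc, one_smul,
    add_sub_cancel_left]
  exact Submodule.smul_mem _ _ (colPart_mem hx)

theorem colY_mem (hV2 : CondV2 V) (hV3 : CondV3 V) {k : Fin (r + 1)} {x : Mat r n}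
    (hx : x ∈ psdCone V) (hs : SuppGE k x) (hc : tdiag x k ≠ 0) :
    colY k x ∈ psdCone V ∧ SuppGE (k + 1) (colY k x) := by
  have hv := colW_sub_mem hx.1 hs hc
  set w := colW k x with hw
  have hxE : x * blkProj k = tdiag x k • w := by
    rw [hw, colW, smul_smul, mul_inv_cancel₀ hc, one_smul]
  have hEw : (blkProj k : Mat r n) * w = blkProj k := by
    have := hv.2.2
    rwa [Matrix.mul_sub, blkProj_mul_self, sub_eq_zero] at this
  have hwE : w * (blkProj k : Mat r n) = w := by
    rw [hw, colW, Matrix.smul_mul, Matrix.mul_assoc, blkProj_mul_self]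
  have hww : w * w = w := by
    nth_rewrite 1 [← hwE]
    rw [Matrix.mul_assoc, hEw, hwE]
  have hEx : (blkProj k : Mat r n) * x = tdiag x k • wᵀ := by
    rw [← Matrix.transpose_smul, ← hxE, Matrix.transpose_mul, blkProj_transpose, hx.1.1]
  have hwx : w * x = tdiag x k • (w * wᵀ) := by
    nth_rewrite 1 [← hwE]
    rw [Matrix.mul_assoc, hEx, Matrix.mul_smul]
  have hxw : x * wᵀ = tdiag x k • (w * wᵀ) := by
    have := congrArg Matrix.transpose hwx
    rwa [Matrix.transpose_mul, hx.1.1, Matrix.transpose_smul, Matrix.transpose_mul,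
      Matrix.transpose_transpose] at this
  have hy : colY k x = (1 - w) * x * (1 - w)ᵀ := by
    have h1 : w * x * wᵀ = tdiag x k • (w * wᵀ) := by
      rw [hwx, Matrix.smul_mul, Matrix.mul_assoc, ← Matrix.transpose_mul, hww]
    rw [colY, ← hw, Matrix.transpose_sub, Matrix.transpose_one, Matrix.sub_mul, Matrix.one_mul,
      Matrix.mul_sub, Matrix.mul_one, Matrix.sub_mul, h1, hwx, hxw]
    abel
  have hwl : w ∈ lowAlg V := by
    have := Submodule.add_mem _ hv.1 (blkProj_mem_lowAlg (V := V) k)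
    rwa [sub_add_cancel] at this
  refine ⟨⟨Submodule.sub_mem _ hx.1 (Submodule.smul_mem _ _
    (mul_transpose_self_mem hV2 hV3 hwl)), ?_⟩, ?_⟩
  · rw [hy]
    have := hx.2.mul_mul_conjTranspose_same (1 - w)
    rwa [Matrix.conjTranspose_eq_transpose_of_trivial] at this
  · have h1 := suppGE_remainder hx.1 hs
    have h2 := suppGE_colSub_mul_transpose hv (w - blkProj k)
    have hvc : colPart k x = tdiag x k • (w - blkProj k) := by
      rw [smul_sub, ← hxE, mul_blkProj_of_suppGE hx.1 hs, add_sub_cancel_left]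
    have h3 : colY k x = (x - tdiag x k • (blkProj k : Mat r n) - colPart k x - (colPart k x)ᵀ) -
        tdiag x k • ((w - blkProj k) * (w - blkProj k)ᵀ) := by
      rw [hvc, colY, ← hw]
      have hw' : w * wᵀ = blkProj k + (w - blkProj k) + (w - blkProj k)ᵀ +
          (w - blkProj k) * (w - blkProj k)ᵀ := by
        have e1 := blkProj_mul_colSub_transpose hv
        have e2 := hv.2.1
        calc w * wᵀ = (blkProj k + (w - blkProj k)) * (blkProj k + (w - blkProj k))ᵀ := by simp
          _ = _ := by
            rw [Matrix.transpose_add, blkProj_transpose, Matrix.add_mul, Matrix.mul_add,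
              Matrix.mul_add, e1, e2, blkProj_mul_self]
            abel
      rw [hw', Matrix.transpose_smul]
      simp only [smul_add]
      abel
    intro p q hp
    rw [h3, Matrix.sub_apply, h1 p q hp, Matrix.smul_apply, h2 p q hp, smul_zero, sub_zero]

theorem mul_blkProj_of_suppGE_succ {k : Fin (r + 1)} {y : Mat r n} (hy : y ∈ Zsub V)
    (hs : SuppGE (k + 1) y) : y * blkProj k = 0 := by
  have := congrArg Matrix.transpose (blkProj_mul_of_suppGE hs)
  rwa [Matrix.transpose_mul, hy.1, blkProj_transpose, Matrix.transpose_zero] at this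

theorem tdiag_colSub {k : Fin (r + 1)} {v : Mat r n} (hv : v ∈ colSub V k) : tdiag v k = 0 := by
  have := tdiag_eq_of_blk (x := v) (k := k) (t := 0)
    (by rw [(mem_colSub_iff.1 hv).1 k k (Or.inr le_rfl), zero_smul])
  exact this

theorem tdiag_colW_colY_eq {k : Fin (r + 1)} {y v : Mat r n} {c : ℝ} (hy : y ∈ Zsub V)
    (hs : SuppGE (k + 1) y) (hv : v ∈ colSub V k) (hc : c ≠ 0) {x : Mat r n}
    (hx : x = y + c • ((blkProj k + v) * (blkProj k + v)ᵀ)) :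
    tdiag x k = c ∧ colW k x = blkProj k + v ∧ colY k x = y := by
  have h0 : (blkProj k + v)ᵀ * (blkProj k : Mat r n) = blkProj k := by
    rw [Matrix.transpose_add, Matrix.add_mul, blkProj_transpose, blkProj_mul_self,
      colSub_transpose_mul_blkProj hv, add_zero]
  have h1 : x * blkProj k = c • (blkProj k + v) := by
    rw [hx, Matrix.add_mul, mul_blkProj_of_suppGE_succ hy hs, zero_add, Matrix.smul_mul,
      Matrix.mul_assoc, h0, Matrix.add_mul, blkProj_mul_self, hv.2.1]
  have h2 : tdiag x k = c := by
    have h3 : tdiag (x * blkProj k) k = tdiag x k := by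
      unfold tdiag
      rw [mul_blkProj_apply, if_pos rfl]
    rw [← h3, h1, tdiag_smul, tdiag_add, tdiag_colSub hv, tdiag_blkProj, if_pos rfl, add_zero,
      mul_one]
  have h4 : colW k x = blkProj k + v := by
    rw [colW, h2, h1, smul_smul, inv_mul_cancel₀ hc, one_smul]
  refine ⟨h2, h4, ?_⟩
  rw [colY, h2, h4, hx, add_sub_cancel_right]

theorem suppGE_rhoM {T y : Mat r n} {j : ℕ} (hT : T ∈ lowAlg V) (hs : SuppGE j y) :
    SuppGE j (T * y * Tᵀ) := by
  have h1 : SuppGE j (T * y) := by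
    intro p q hp
    rw [Matrix.mul_apply]
    refine Finset.sum_eq_zero fun m _ => ?_
    by_cases hm : m.1.val < j
    · rw [hs m q hm, mul_zero]
    · have hlt : p.1 < m.1 := Fin.lt_def.2 (by omega)
      have := congrFun (congrFun (hT.1 m.1 p.1 hlt) p.2) m.2
      rw [blk_apply] at this
      have h' : T p m = 0 := this
      rw [h', zero_mul]
  intro p q hp
  rw [Matrix.mul_apply]
  exact Finset.sum_eq_zero fun m _ => by rw [h1 p m hp, zero_mul]

theorem eq_colY_add (k : Fin (r + 1)) (x : Mat r n) :
    x = colY k x + tdiag x k • ((blkProj k + (colW k x - blkProj k)) *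
      (blkProj k + (colW k x - blkProj k))ᵀ) := by
  rw [add_sub_cancel, colY, sub_add_cancel]

theorem decomposition_rhoM (hV1 : CondV1 V) (hV2 : CondV2 V) (hV3 : CondV3 V) {k : Fin (r + 1)}
    {x τ u : Mat r n} (hx : x ∈ psdCone V) (hs : SuppGE k x) (hc : tdiag x k ≠ 0)
    (hτ : τ ∈ lowAlg V) (hu : u ∈ colSub V k) (hτu : τ * blkProj k = blkProj k + u) :
    tdiag (τ * x * τᵀ) k = tdiag x k ∧
      colW k (τ * x * τᵀ) = blkProj k + (u + τ * (colW k x - blkProj k)) ∧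
      colY k (τ * x * τᵀ) = τ * colY k x * τᵀ := by
  have hv := colW_sub_mem hx.1 hs hc
  have hy := colY_mem hV2 hV3 hx hs hc
  refine tdiag_colW_colY_eq (rhoM_mem hV1 hV2 hV3 hτ hy.1.1) (suppGE_rhoM hτ hy.2)
    (Submodule.add_mem _ hu (colSub_mul hV1 hτ hv)) hc ?_
  have h1 : blkProj k + (u + τ * (colW k x - blkProj k)) = τ * colW k x := by
    rw [Matrix.mul_sub, hτu]
    abel
  rw [h1]
  nth_rewrite 1 [eq_colY_add k x]
  rw [add_sub_cancel, Matrix.mul_add, Matrix.add_mul, Matrix.mul_smul, Matrix.smul_mul,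
    Matrix.transpose_mul]
  simp only [Matrix.mul_assoc]

theorem trace_eq_colY {k : Fin (r + 1)} {x : Mat r n} (hx : x ∈ Zsub V) (hs : SuppGE k x)
    (hc : tdiag x k ≠ 0) : x.trace = (colY k x).trace + tdiag x k *
      (n k + ((colW k x - blkProj k) * (colW k x - blkProj k)ᵀ).trace) := by
  nth_rewrite 1 [eq_colY_add k x]
  rw [Matrix.trace_add, Matrix.trace_smul, smul_eq_mul]
  have := trace_smul_blkProj_add (colW_sub_mem hx hs hc) 1
  rw [one_smul, one_pow, one_mul] at this
  rw [this]

theorem continuous_tdiag (k : Fin (r + 1)) : Continuous fun x : Mat r n => tdiag x k := by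
  unfold tdiag
  fun_prop

theorem measurable_colW (k : Fin (r + 1)) : Measurable fun x : Mat r n => colW k x := by
  have h : Measurable fun x : Mat r n => x * blkProj k :=
    (continuous_id.mul continuous_const).measurable
  exact (continuous_tdiag k).measurable.inv.smul h

theorem measurable_colY (k : Fin (r + 1)) : Measurable fun x : Mat r n => colY k x := by
  have h : Continuous fun p : ℝ × Mat r n => p.1 • (p.2 * p.2ᵀ) := by fun_prop
  exact measurable_id.sub
    (h.measurable.comp ((continuous_tdiag k).measurable.prodMk (measurable_colW k)))

end Decomposition

section RelativeInvariance

variable {V : ∀ l k : Fin (r + 1), Submodule ℝ (Matrix (Fin (n l)) (Fin (n k)) ℝ)}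

/-- `μ` is concentrated on elements of the closed cone whose first `k` block rows vanish, and its
Laplace transform is `C χ_{-σ}`. -/
structure IsRiesz (V : ∀ l k : Fin (r + 1), Submodule ℝ (Matrix (Fin (n l)) (Fin (n k)) ℝ))
    (k : ℕ) (σ : Fin (r + 1) → ℝ) (C : ℝ) (μ : Measure (Mat r n)) : Prop where
  mem : ∀ᵐ x ∂μ, x ∈ psdCone V
  supp : ∀ᵐ x ∂μ, SuppGE k x
  pos : 0 < C
  lapH_eq : ∀ T ∈ Hgrp V, lapH μ T = ENNReal.ofReal (C * chi (-σ) T)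

theorem IsRiesz.map_rhoM (hV1 : CondV1 V) (hV2 : CondV2 V) (hV3 : CondV3 V) {k : ℕ}
    {σ : Fin (r + 1) → ℝ} {C : ℝ} {μ : Measure (Mat r n)} (h : IsRiesz V k σ C μ) {T : Mat r n}
    (hT : T ∈ Hgrp V) :
    μ.map (fun x => T * x * Tᵀ) = ENNReal.ofReal (chi (-σ) T) • μ := by
  have hc : Continuous fun x : Mat r n => T * x * Tᵀ := by fun_prop
  have hlap : ∀ S ∈ Hgrp V, lapH (μ.map fun x => T * x * Tᵀ) S = lapH μ (S * T) := by
    intro S _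
    rw [lapH, lintegral_map (measurable_ofReal_exp_neg (continuous_trace_rhoM S)) hc.measurable,
      lapH]
    refine lintegral_congr fun x => ?_
    rw [Matrix.transpose_mul]
    simp only [Matrix.mul_assoc]
  refine ext_of_lapH hV1 hV2 hV3 ?_ ?_ ?_ fun S hS => ?_
  · rw [Measure.map_apply hc.measurable measurableSet_psdCone.compl]
    refine measure_eq_zero_iff_ae_notMem.2 ?_
    filter_upwards [h.mem] with x hx hx'
    exact hx' (rhoM_mem_psdCone hV1 hV2 hV3 (mem_Hgrp_iff.1 hT).1 hx)
  · have : μ (psdCone V)ᶜ = 0 := h.mem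
    simp [this]
  · rw [hlap 1 one_mem_Hgrp, Matrix.one_mul, h.lapH_eq T hT]
    exact ENNReal.ofReal_ne_top
  · rw [hlap S hS, h.lapH_eq _ (Hgrp_mul hV1 hS hT), chi_mul hS hT, lapH, lintegral_smul_measure,
      ← lapH, h.lapH_eq S hS, smul_eq_mul, ← ENNReal.ofReal_mul (chi_pos hT _).le]
    congr 1
    ring

/-- The diagonal matrix with `t` in the `k`-th diagonal block and `1` in the others. -/
def diagT (k : Fin (r + 1)) (t : ℝ) : Mat r n := 1 + (t - 1) • blkProj k

theorem tdiag_diagT (k j : Fin (r + 1)) (t : ℝ) :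
    tdiag (diagT k t : Mat r n) j = if j = k then t else 1 := by
  rw [diagT, tdiag_add, tdiag_one, tdiag_smul, tdiag_blkProj]
  split_ifs <;> ring

theorem diagT_mem (k : Fin (r + 1)) {t : ℝ} (ht : 0 < t) : (diagT k t : Mat r n) ∈ Hgrp V := by
  rw [mem_Hgrp_iff]
  refine ⟨Submodule.add_mem _ one_mem_lowAlg (Submodule.smul_mem _ _ (blkProj_mem_lowAlg k)),
    fun j => ?_⟩
  rw [tdiag_diagT]
  split_ifs
  exacts [ht, one_pos]

theorem chi_diagT (k : Fin (r + 1)) (t : ℝ) (s : Fin (r + 1) → ℝ) :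
    chi s (diagT k t : Mat r n) = t ^ (2 * s k) := by
  unfold chi
  rw [Finset.prod_eq_single k]
  · rw [tdiag_diagT, if_pos rfl]
  · intro j _ hj
    rw [tdiag_diagT, if_neg hj, Real.one_rpow]
  · simp

theorem trace_mul_blkProj {x : Mat r n} (hx : x ∈ Zsub V) (k : Fin (r + 1)) :
    (x * blkProj k).trace = n k * tdiag x k := by
  have h1 : ∀ p : Idx r n, (x * blkProj k : Mat r n) p p =
      if p.1 = k then tdiag x k else 0 := by
    rintro ⟨l, a⟩
    rw [mul_blkProj_apply]
    split_ifs with h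
    · obtain rfl : l = k := h
      have := congrFun (congrFun (blk_diag_Z hx l) a) a
      simpa [blk_apply] using this
    · rfl
  unfold Matrix.trace
  simp only [Matrix.diag_apply, h1]
  rw [Fintype.sum_sigma, Finset.sum_eq_single k]
  · simp
  · intro l _ hl
    simp [hl]
  · simp

theorem trace_diagT {x : Mat r n} (hx : x ∈ Zsub V) (k : Fin (r + 1)) (t : ℝ) :
    ((diagT k t : Mat r n) * x * (diagT k t : Mat r n)ᵀ).trace =
      x.trace + (t ^ 2 - 1) * (n k * tdiag x k) := by
  have h1 : ((diagT k t : Mat r n))ᵀ * diagT k t = 1 + (t ^ 2 - 1) • blkProj k := by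
    rw [diagT, Matrix.transpose_add, Matrix.transpose_one, Matrix.transpose_smul,
      blkProj_transpose, Matrix.add_mul, Matrix.mul_add, Matrix.mul_add]
    simp only [Matrix.smul_mul, Matrix.mul_smul, smul_smul, blkProj_mul_self, Matrix.one_mul,
      Matrix.mul_one]
    module
  rw [Matrix.mul_assoc, Matrix.trace_mul_comm, Matrix.mul_assoc, h1, Matrix.mul_add,
    Matrix.mul_one, Matrix.mul_smul, Matrix.trace_add, Matrix.trace_smul, trace_mul_blkProj hx,
    smul_eq_mul]

variable {σ : Fin (r + 1) → ℝ} {C : ℝ} {μ : Measure (Mat r n)}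

theorem IsRiesz.lapH_diagT {j : ℕ} (h : IsRiesz V j σ C μ) (k : Fin (r + 1)) {t : ℝ}
    (ht : 0 < t) : lapH μ (diagT k t) = ENNReal.ofReal (C * t ^ (-(2 * σ k))) := by
  rw [h.lapH_eq _ (diagT_mem k ht), chi_diagT, Pi.neg_apply, mul_neg]

theorem IsRiesz.lapH_one {j : ℕ} (h : IsRiesz V j σ C μ) : lapH μ 1 = ENNReal.ofReal C := by
  rw [h.lapH_eq _ one_mem_Hgrp]
  simp [chi, tdiag_one]

theorem exp_trace_diagT_le {x : Mat r n} (hx : x ∈ psdCone V) (k : Fin (r + 1)) {t : ℝ}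
    (ht : 1 ≤ t) :
    ENNReal.ofReal (Real.exp (-((diagT k t : Mat r n) * x * (diagT k t : Mat r n)ᵀ).trace)) ≤
      ENNReal.ofReal (Real.exp (-((1 : Mat r n) * x * (1 : Mat r n)ᵀ).trace)) := by
  refine ENNReal.ofReal_le_ofReal (Real.exp_le_exp.2 (neg_le_neg ?_))
  rw [trace_diagT hx.1, Matrix.one_mul, Matrix.transpose_one, Matrix.mul_one]
  have h1 := tdiag_nonneg hx k
  have h2 : 0 ≤ t ^ 2 - 1 := by nlinarith
  have h3 : (0 : ℝ) ≤ n k := Nat.cast_nonneg _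
  have := mul_nonneg h2 (mul_nonneg h3 h1)
  linarith

theorem IsRiesz.nonneg {j : ℕ} (h : IsRiesz V j σ C μ) (k : Fin (r + 1)) : 0 ≤ σ k := by
  have h1 : lapH μ (diagT k 2) ≤ lapH μ 1 := by
    refine lintegral_mono_ae ?_
    filter_upwards [h.mem] with x hx
    exact exp_trace_diagT_le hx k one_le_two
  rw [h.lapH_diagT k two_pos, h.lapH_one, ENNReal.ofReal_le_ofReal_iff h.pos.le] at h1
  have h2 : (2 : ℝ) ^ (-(2 * σ k)) ≤ 2 ^ (0 : ℝ) := by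
    rw [Real.rpow_zero]
    exact le_of_mul_le_mul_left (by linarith) h.pos
  rw [Real.rpow_le_rpow_left_iff one_lt_two] at h2
  linarith

theorem IsRiesz.ae_tdiag_eq_zero {j : ℕ} (h : IsRiesz V j σ C μ) {k : Fin (r + 1)}
    (hk : σ k = 0) : ∀ᵐ x ∂μ, tdiag x k = 0 := by
  have h2 : lapH μ (diagT k 2) = ENNReal.ofReal C := by
    rw [h.lapH_diagT k two_pos, hk]
    simp
  have h3 := ae_eq_of_ae_le_of_lintegral_le (μ := μ)
    (f := fun x => ENNReal.ofReal
      (Real.exp (-((diagT k 2 : Mat r n) * x * (diagT k 2 : Mat r n)ᵀ).trace)))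
    (g := fun x => ENNReal.ofReal (Real.exp (-((1 : Mat r n) * x * (1 : Mat r n)ᵀ).trace)))
    (by
      filter_upwards [h.mem] with x hx
      exact exp_trace_diagT_le hx k one_le_two)
    (by
      change lapH μ _ ≠ ∞
      rw [h2]
      exact ENNReal.ofReal_ne_top)
    (measurable_ofReal_exp_neg (continuous_trace_rhoM 1)).aemeasurable
    (by
      change lapH μ 1 ≤ lapH μ _
      rw [h2, h.lapH_one])
  filter_upwards [h3, h.mem] with x hx hxm
  rw [ENNReal.ofReal_eq_ofReal_iff (Real.exp_pos _).le (Real.exp_pos _).le, Real.exp_eq_exp,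
    trace_diagT hxm.1, Matrix.one_mul, Matrix.transpose_one, Matrix.mul_one] at hx
  have h4 : (n k : ℝ) * tdiag x k = 0 := by linarith
  exact (mul_eq_zero.1 h4).resolve_left (Nat.cast_ne_zero.2 (n k).ne_zero)

theorem IsRiesz.ae_tdiag_ne_zero {j : ℕ} (h : IsRiesz V j σ C μ) {k : Fin (r + 1)}
    (hk : 0 < σ k) : ∀ᵐ x ∂μ, tdiag x k ≠ 0 := by
  have hms : MeasurableSet {x : Mat r n | tdiag x k = 0} :=
    (continuous_tdiag k).measurable (measurableSet_singleton 0)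
  have hle : ∀ t : ℝ, 0 < t →
      ∫⁻ x in {x : Mat r n | tdiag x k = 0}, ENNReal.ofReal (Real.exp (-x.trace)) ∂μ ≤
      ENNReal.ofReal (C * t ^ (-(2 * σ k))) := by
    intro t ht
    rw [← h.lapH_diagT k ht]
    refine le_trans (setLIntegral_mono_ae ?_ ?_) (setLIntegral_le_lintegral _ _)
    · exact (measurable_ofReal_exp_neg (continuous_trace_rhoM _)).aemeasurable
    · filter_upwards [h.mem] with x hx hx0
      rw [trace_diagT hx.1, show tdiag x k = 0 from hx0]
      simp
  have ht : Filter.Tendsto (fun t : ℝ => ENNReal.ofReal (C * t ^ (-(2 * σ k)))) Filter.atTop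
      (nhds 0) := by
    have h1 := (tendsto_rpow_neg_atTop (y := 2 * σ k) (by positivity)).const_mul C
    rw [mul_zero] at h1
    have h2 := ENNReal.tendsto_ofReal h1
    rwa [ENNReal.ofReal_zero] at h2
  have h0 : ∫⁻ x in {x : Mat r n | tdiag x k = 0}, ENNReal.ofReal (Real.exp (-x.trace)) ∂μ = 0 :=
    le_antisymm (ge_of_tendsto ht
      ((Filter.eventually_gt_atTop 0).mono fun t ht => hle t ht)) bot_le
  rw [lintegral_eq_zero_iff (measurable_ofReal_exp_neg (by fun_prop)), Filter.EventuallyEq,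
    ae_restrict_iff' hms] at h0
  filter_upwards [h0] with x hx hx0
  exact (ENNReal.ofReal_pos.2 (Real.exp_pos _)).ne' (hx hx0)

end RelativeInvariance

section ColumnReduction

variable {V : ∀ l k : Fin (r + 1), Submodule ℝ (Matrix (Fin (n l)) (Fin (n k)) ℝ)}
  {σ : Fin (r + 1) → ℝ} {C : ℝ} {μ : Measure (Mat r n)} {k : Fin (r + 1)} {d : ℕ}
  {J : EuclideanSpace ℝ (Fin d) →ₗ[ℝ] Mat r n}
  {π : Mat r n →ₗ[ℝ] EuclideanSpace ℝ (Fin d)}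

/-- Coordinates of `x`: the `k`-th diagonal entry, the normalized `k`-th block column and the
Schur complement. -/
noncomputable def coords (k : Fin (r + 1)) (π : Mat r n →ₗ[ℝ] EuclideanSpace ℝ (Fin d))
    (x : Mat r n) : ℝ × EuclideanSpace ℝ (Fin d) × Mat r n :=
  (tdiag x k, π (colW k x - blkProj k), colY k x)

theorem measurable_coords : Measurable (coords k π) := by
  have hπ : Measurable π := (LinearMap.continuous_of_finiteDimensional π).measurable
  exact (continuous_tdiag k).measurable.prodMk
    ((hπ.comp ((measurable_colW k).sub measurable_const)).prodMk (measurable_colY k))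

theorem IsRiesz.lintegral_coords (hV1 : CondV1 V) (hV2 : CondV2 V) (hV3 : CondV3 V)
    (h : IsRiesz V k σ C μ) (hk : 0 < σ k) (hJ : ∀ u, J u ∈ colSub V k) (hπ : ∀ u, π (J u) = u)
    (hJπ : ∀ w ∈ colSub V k, J (π w) = w) {τ : Mat r n} (hτ : τ ∈ Hgrp V)
    {u₀ : EuclideanSpace ℝ (Fin d)} (hu₀ : τ * blkProj k = blkProj k + J u₀)
    {φ : EuclideanSpace ℝ (Fin d) →ₗ[ℝ] EuclideanSpace ℝ (Fin d)} (hφ : ∀ u, J (φ u) = τ * J u)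
    {G : ℝ × EuclideanSpace ℝ (Fin d) × Mat r n → ℝ≥0∞} (hG : Measurable G) :
    ∫⁻ x, G ((coords k π x).1, u₀ + φ (coords k π x).2.1, τ * (coords k π x).2.2 * τᵀ) ∂μ =
      ENNReal.ofReal (chi (-σ) τ) * ∫⁻ x, G (coords k π x) ∂μ := by
  have hc : Continuous fun x : Mat r n => τ * x * τᵀ := by fun_prop
  have h1 := congrArg (fun m => ∫⁻ x, G (coords k π x) ∂m) (h.map_rhoM hV1 hV2 hV3 hτ)
  simp only [lintegral_smul_measure, smul_eq_mul] at h1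
  have hGm : Measurable fun x => G (coords k π x) := hG.comp measurable_coords
  rw [← h1, lintegral_map hGm hc.measurable]
  refine lintegral_congr_ae ?_
  filter_upwards [h.mem, h.supp, h.ae_tdiag_ne_zero hk] with x hx hs hx0
  obtain ⟨e1, e2, e3⟩ := decomposition_rhoM hV1 hV2 hV3 hx hs hx0 (mem_Hgrp_iff.1 hτ).1 (hJ u₀) hu₀
  have hv := hJπ _ (colW_sub_mem hx.1 hs hx0)
  have e4 : colW k (τ * x * τᵀ) - blkProj k = J (u₀ + φ (π (colW k x - blkProj k))) := by
    rw [e2, add_sub_cancel_left, map_add, hφ, hv]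
  simp only [coords, e1, e4, e3, hπ]

theorem lower_mul_eq_of_suppGE {T y : Mat r n} (hs : SuppGE (k + 1) y) :
    (T * (1 - blkProj k) + blkProj k) * y = T * y := by
  rw [Matrix.add_mul, Matrix.mul_assoc, Matrix.sub_mul, blkProj_mul_of_suppGE hs, Matrix.one_mul,
    sub_zero, add_zero]

theorem tdiag_replace {T : Mat r n} (hT : T ∈ lowAlg V) (j : Fin (r + 1)) :
    tdiag (T * (1 - blkProj k) + blkProj k) j = if j = k then 1 else tdiag T j := by
  rw [tdiag_add, tdiag_mul hT (Submodule.sub_mem _ one_mem_lowAlg (blkProj_mem_lowAlg k)),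
    tdiag_sub, tdiag_one, tdiag_blkProj]
  split_ifs <;> ring

theorem replace_mem (hV1 : CondV1 V) {T : Mat r n} (hT : T ∈ Hgrp V) :
    T * (1 - blkProj k) + blkProj k ∈ Hgrp V := by
  rw [mem_Hgrp_iff] at *
  refine ⟨Submodule.add_mem _ (lowAlg_mul hV1 hT.1
    (Submodule.sub_mem _ one_mem_lowAlg (blkProj_mem_lowAlg k))) (blkProj_mem_lowAlg k),
    fun j => ?_⟩
  rw [tdiag_replace hT.1]
  split_ifs
  exacts [one_pos, hT.2 j]

theorem replace_mul_blkProj (T : Mat r n) :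
    (T * (1 - blkProj k) + blkProj k) * blkProj k = blkProj k := by
  rw [Matrix.add_mul, Matrix.mul_assoc, Matrix.sub_mul, blkProj_mul_self, Matrix.one_mul,
    sub_self, Matrix.mul_zero, zero_add]

theorem chi_replace_mul_colJac {T : Mat r n} (hT : T ∈ Hgrp V) :
    chi (-σ) (T * (1 - blkProj k) + blkProj k) *
      colJac V k (T * (1 - blkProj k) + blkProj k) =
    chi (-fun j => if j = k then 0 else σ j - 1 / 2 * colDim V k j) T := by
  unfold chi colJac
  rw [← Finset.prod_mul_distrib]
  refine Finset.prod_congr rfl fun j _ => ?_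
  have hT' := mem_Hgrp_iff.1 hT
  rw [tdiag_replace hT'.1, Pi.neg_apply, Pi.neg_apply]
  split_ifs with hj
  · simp
  · rw [← Real.rpow_natCast, ← Real.rpow_add (hT'.2 j)]
    congr 1
    ring

/-- The law of the normalized `k`-th block column, weighted by the Schur complement. -/
noncomputable def colMeasure (μ : Measure (Mat r n)) (k : Fin (r + 1))
    (π : Mat r n →ₗ[ℝ] EuclideanSpace ℝ (Fin d)) (A : Set ℝ) :
    Measure (EuclideanSpace ℝ (Fin d)) :=
  ((μ.restrict {x | tdiag x k ∈ A}).withDensity fun x =>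
    ENNReal.ofReal (Real.exp (-(coords k π x).2.2.trace))).map fun x => (coords k π x).2.1

theorem lintegral_colMeasure {A : Set ℝ} (hA : MeasurableSet A)
    {g : EuclideanSpace ℝ (Fin d) → ℝ≥0∞} (hg : Measurable g) :
    ∫⁻ u, g u ∂(colMeasure μ k π A) = ∫⁻ x, A.indicator 1 (coords k π x).1 *
      (ENNReal.ofReal (Real.exp (-(coords k π x).2.2.trace)) * g (coords k π x).2.1) ∂μ := by
  have hc := measurable_coords (k := k) (π := π)
  have hD : Measurable fun x => ENNReal.ofReal (Real.exp (-(coords k π x).2.2.trace)) :=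
    (measurable_ofReal_exp_neg (f := Matrix.trace) (by fun_prop)).comp hc.snd.snd
  have hS : MeasurableSet {x : Mat r n | tdiag x k ∈ A} := (continuous_tdiag k).measurable hA
  have hgm : Measurable fun x => g (coords k π x).2.1 := hg.comp hc.snd.fst
  rw [colMeasure, lintegral_map hg hc.snd.fst,
    lintegral_withDensity_eq_lintegral_mul _ hD hgm, ← lintegral_indicator hS]
  refine lintegral_congr fun x => ?_
  by_cases hx : tdiag x k ∈ A
  · rw [Set.indicator_of_mem (show x ∈ {x : Mat r n | tdiag x k ∈ A} from hx),
      Set.indicator_of_mem (show (coords k π x).1 ∈ A from hx), Pi.one_apply, one_mul]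
    rfl
  · rw [Set.indicator_of_notMem (show x ∉ {x : Mat r n | tdiag x k ∈ A} from hx),
      Set.indicator_of_notMem (show (coords k π x).1 ∉ A from hx), zero_mul]

theorem colMeasure_lt_top (h : IsRiesz V k σ C μ) (hk : 0 < σ k)
    (hJπ : ∀ w ∈ colSub V k, J (π w) = w) {a b : ℝ} {K : Set (EuclideanSpace ℝ (Fin d))}
    (hK : IsCompact K) : colMeasure μ k π (Set.Icc a b) K < ∞ := by
  have hJc : Continuous J := LinearMap.continuous_of_finiteDimensional J
  have hcont : Continuous fun u => (J u * (J u)ᵀ).trace := by fun_prop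
  obtain ⟨B, hB⟩ := (hK.image hcont).bddAbove
  have hle : colMeasure μ k π (Set.Icc a b) K ≤
      ∫⁻ x, ENNReal.ofReal (Real.exp (b * (n k + B))) *
        ENNReal.ofReal (Real.exp (-((1 : Mat r n) * x * (1 : Mat r n)ᵀ).trace)) ∂μ := by
    rw [← lintegral_indicator_one hK.measurableSet,
      lintegral_colMeasure measurableSet_Icc (measurable_one.indicator hK.measurableSet)]
    refine lintegral_mono_ae ?_
    filter_upwards [h.mem, h.supp, h.ae_tdiag_ne_zero hk] with x hx hs hx0
    by_cases hxA : (coords k π x).1 ∈ Set.Icc a b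
    · by_cases hxK : (coords k π x).2.1 ∈ K
      · rw [Set.indicator_of_mem hxA, Set.indicator_of_mem hxK, Pi.one_apply, Pi.one_apply,
          one_mul, mul_one, ← ENNReal.ofReal_mul (Real.exp_pos _).le, ← Real.exp_add]
        refine ENNReal.ofReal_le_ofReal (Real.exp_le_exp.2 ?_)
        rw [Matrix.one_mul, Matrix.transpose_one, Matrix.mul_one, trace_eq_colY hx.1 hs hx0]
        have h1 := hB (Set.mem_image_of_mem _ hxK)
        simp only [coords, hJπ _ (colW_sub_mem hx.1 hs hx0)] at h1
        have h2 : tdiag x k ≤ b := hxA.2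
        have h3 := tdiag_nonneg hx k
        have h4 := trace_mul_transpose_self_nonneg (colW k x - blkProj k)
        have h5 : (0 : ℝ) ≤ n k := Nat.cast_nonneg _
        have h6 : tdiag x k * (n k + ((colW k x - blkProj k) * (colW k x - blkProj k)ᵀ).trace) ≤
            b * (n k + B) := by
          refine mul_le_mul h2 (by linarith) (by linarith) (h3.trans h2)
        simp only [coords]
        linarith
      · rw [Set.indicator_of_notMem hxK, mul_zero, mul_zero]
        exact bot_le
    · rw [Set.indicator_of_notMem hxA, zero_mul]
      exact bot_le
  refine hle.trans_lt ?_
  rw [lintegral_const_mul' _ _ ENNReal.ofReal_ne_top, ← lapH, h.lapH_one]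
  exact ENNReal.mul_lt_top ENNReal.ofReal_lt_top ENNReal.ofReal_lt_top

theorem colMeasure_isAddHaar (hV1 : CondV1 V) (hV2 : CondV2 V) (hV3 : CondV3 V)
    (h : IsRiesz V k σ C μ) (hk : 0 < σ k) (hJ : ∀ u, J u ∈ colSub V k) (hπ : ∀ u, π (J u) = u)
    (hJπ : ∀ w ∈ colSub V k, J (π w) = w) :
    ∃ a b : ℝ, (colMeasure μ k π (Set.Icc a b)).IsAddHaarMeasure := by
  have hex : ∃ m : ℕ, μ {x | tdiag x k ∈ Set.Icc (-(m : ℝ)) m} ≠ 0 := by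
    by_contra! hall
    have h1 : ∀ᵐ x ∂μ, ∀ m : ℕ, tdiag x k ∉ Set.Icc (-(m : ℝ)) m :=
      ae_all_iff.2 fun m => measure_eq_zero_iff_ae_notMem.1 (hall m)
    have h2 : ∀ᵐ _ ∂μ, False := by
      filter_upwards [h1] with x hx
      obtain ⟨m, hm⟩ := exists_nat_ge |tdiag x k|
      exact hx m (abs_le.1 hm)
    rw [Filter.eventually_false_iff_eq_bot, ae_eq_bot] at h2
    have h3 := h.lapH_one
    rw [h2, lapH, lintegral_zero_measure] at h3
    exact (ENNReal.ofReal_pos.2 h.pos).ne h3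
  obtain ⟨m, hm⟩ := hex
  refine ⟨-(m : ℝ), m, ?_⟩
  set A := Set.Icc (-(m : ℝ)) m with hA
  have hAm : MeasurableSet A := measurableSet_Icc
  have hinv : (colMeasure μ k π A).IsAddLeftInvariant := by
    refine ⟨fun u₀ => Measure.ext fun B hB => ?_⟩
    rw [Measure.map_apply (measurable_const_add u₀) hB,
      ← lintegral_indicator_one hB, ← lintegral_indicator_one (measurable_const_add u₀ hB),
      lintegral_colMeasure hAm (measurable_one.indicator hB),
      lintegral_colMeasure hAm (measurable_one.indicator (measurable_const_add u₀ hB))]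
    have ht : ∀ j, tdiag (1 + J u₀) j = 1 := fun j => by
      have h0 : tdiag (J u₀) j = 0 := tdiag_eq_of_blk (by
        rw [(mem_colSub_iff.1 (hJ u₀)).1 j j, zero_smul]
        by_cases hj : j = k
        · exact Or.inr hj.le
        · exact Or.inl hj)
      rw [tdiag_add, tdiag_one, h0, add_zero]
    have hτ : 1 + J u₀ ∈ Hgrp V := mem_Hgrp_iff.2
      ⟨Submodule.add_mem _ one_mem_lowAlg (hJ u₀).1, fun j => (ht j).symm ▸ one_pos⟩
    have hchi : chi (-σ) (1 + J u₀) = 1 := by simp [chi, ht]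
    have hJJ : ∀ u, J u₀ * J u = 0 := fun u => by
      rw [← (hJ u₀).2.1, Matrix.mul_assoc, (hJ u).2.2, Matrix.mul_zero]
    have key := h.lintegral_coords hV1 hV2 hV3 hk hJ hπ hJπ hτ (u₀ := u₀)
      (by rw [Matrix.add_mul, Matrix.one_mul, (hJ u₀).2.1]) (φ := LinearMap.id)
      (fun u => by rw [Matrix.add_mul, hJJ, Matrix.one_mul, add_zero, LinearMap.id_apply])
      (G := fun p => A.indicator 1 p.1 *
        (ENNReal.ofReal (Real.exp (-p.2.2.trace)) * B.indicator 1 p.2.1))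
      (((measurable_one.indicator hAm).comp measurable_fst).mul
        (((measurable_ofReal_exp_neg (f := Matrix.trace) (by fun_prop)).comp
          measurable_snd.snd).mul ((measurable_one.indicator hB).comp measurable_snd.fst)))
    rw [hchi, ENNReal.ofReal_one, one_mul] at key
    rw [← key]
    refine lintegral_congr_ae ?_
    filter_upwards [h.mem, h.supp, h.ae_tdiag_ne_zero hk] with x hx hs hx0
    have hy := colY_mem hV2 hV3 hx hs hx0
    have h1 : (1 + J u₀) * colY k x = colY k x := by
      rw [Matrix.add_mul, ← (hJ u₀).2.1, Matrix.mul_assoc, blkProj_mul_of_suppGE hy.2,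
        Matrix.mul_zero, Matrix.one_mul, add_zero]
    have h2 : (1 + J u₀) * colY k x * (1 + J u₀)ᵀ = colY k x := by
      have := congrArg Matrix.transpose h1
      rw [Matrix.transpose_mul, hy.1.1.1] at this
      rw [h1, this]
    simp only [coords, h2, LinearMap.id_apply]
    rfl
  have hfin : IsFiniteMeasureOnCompacts (colMeasure μ k π A) :=
    ⟨fun K hK => colMeasure_lt_top h hk hJπ hK⟩
  have hne : colMeasure μ k π A ≠ 0 := by
    intro h0
    have h1 := lintegral_colMeasure (μ := μ) (k := k) (π := π) hAm (g := 1) measurable_one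
    have hc := measurable_coords (k := k) (π := π)
    have hm' : Measurable fun x => A.indicator (1 : ℝ → ℝ≥0∞) (coords k π x).1 *
        (ENNReal.ofReal (Real.exp (-(coords k π x).2.2.trace)) *
          (1 : EuclideanSpace ℝ (Fin d) → ℝ≥0∞) (coords k π x).2.1) :=
      ((measurable_one.indicator hAm).comp hc.fst).mul
        (((measurable_ofReal_exp_neg (f := Matrix.trace) (by fun_prop)).comp hc.snd.snd).mul
          measurable_const)
    rw [h0, lintegral_zero_measure, eq_comm, lintegral_eq_zero_iff hm'] at h1
    refine hm (measure_eq_zero_iff_ae_notMem.2 ?_)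
    filter_upwards [h1] with x hx hxA
    have hxA' : (coords k π x).1 ∈ A := hxA
    simp only [Set.indicator_of_mem hxA', Pi.one_apply, one_mul, mul_one, Pi.zero_apply] at hx
    exact (ENNReal.ofReal_pos.2 (Real.exp_pos _)).ne' hx
  have : NeZero (colMeasure μ k π A) := ⟨hne⟩
  have hopen : (colMeasure μ k π A).IsOpenPosMeasure :=
    isOpenPosMeasure_of_addLeftInvariant_of_regular
  exact { }

theorem IsRiesz.step (hV1 : CondV1 V) (hV2 : CondV2 V) (hV3 : CondV3 V)
    (h : IsRiesz V k σ C μ) (hk : 0 < σ k) :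
    ∃ C' ν, IsRiesz V (k + 1) (fun j => if j = k then 0 else σ j - 1 / 2 * colDim V k j) C' ν := by
  obtain ⟨d, J, hJi, hJm, hJφ⟩ := exists_coord hV1 k
  obtain ⟨π, hπ'⟩ := LinearMap.exists_leftInverse_of_injective J (LinearMap.ker_eq_bot.2 hJi)
  have hJ : ∀ u, J u ∈ colSub V k := fun u => (hJm _).2 ⟨u, rfl⟩
  have hπ : ∀ u, π (J u) = u := fun u => LinearMap.congr_fun hπ' u
  have hJπ : ∀ w ∈ colSub V k, J (π w) = w := by
    intro w hw
    obtain ⟨u, rfl⟩ := (hJm w).1 hw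
    rw [hπ]
  obtain ⟨a, b, hHaar⟩ := colMeasure_isAddHaar hV1 hV2 hV3 h hk hJ hπ hJπ
  set A := Set.Icc a b with hA
  have hAm : MeasurableSet A := measurableSet_Icc
  set lam := colMeasure μ k π A with hlam
  let B : Set (EuclideanSpace ℝ (Fin d)) := Metric.closedBall 0 1
  have hBc : IsCompact B := isCompact_closedBall 0 1
  have hBm : MeasurableSet B := hBc.measurableSet
  have hB0 : lam B ≠ 0 := (Metric.measure_closedBall_pos lam 0 one_pos).ne'
  have hBt : lam B ≠ ∞ := hBc.measure_lt_top.ne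
  have hc := measurable_coords (k := k) (π := π)
  let S : Set (Mat r n) := {x | (coords k π x).1 ∈ A ∧ (coords k π x).2.1 ∈ B}
  have hS : MeasurableSet S := (hc.fst hAm).inter (hc.snd.fst hBm)
  refine ⟨(lam B).toReal, (μ.restrict S).map (colY k), ?_, ?_, ENNReal.toReal_pos hB0 hBt,
    fun T hT => ?_⟩
  · refine (ae_map_iff (p := fun x => x ∈ psdCone V) (measurable_colY k).aemeasurable
      measurableSet_psdCone).2 ?_
    refine ae_restrict_of_ae ?_
    filter_upwards [h.mem, h.supp, h.ae_tdiag_ne_zero hk] with x hx hs hx0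
    exact (colY_mem hV2 hV3 hx hs hx0).1
  · have hms : MeasurableSet {x : Mat r n | SuppGE (k + 1) x} := by
      have : {x : Mat r n | SuppGE (k + 1) x} =
          ⋂ p : Idx r n, ⋂ q : Idx r n, {x | p.1.val < k + 1 → x p q = 0} := by
        ext x
        simp [SuppGE]
      rw [this]
      refine MeasurableSet.iInter fun p => MeasurableSet.iInter fun q => ?_
      by_cases hp : p.1.val < k + 1
      · simp only [hp, true_imp_iff]
        exact (isClosed_eq (by fun_prop) continuous_const).measurableSet
      · simp [hp]
    rw [ae_map_iff (measurable_colY k).aemeasurable hms]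
    refine ae_restrict_of_ae ?_
    filter_upwards [h.mem, h.supp, h.ae_tdiag_ne_zero hk] with x hx hs hx0
    exact (colY_mem hV2 hV3 hx hs hx0).2
  · set τ := T * (1 - blkProj k) + blkProj k with hτdef
    have hτ : τ ∈ Hgrp V := replace_mem hV1 hT
    obtain ⟨φ, hφ, hdet⟩ := hJφ τ (mem_Hgrp_iff.1 hτ).1
    have hcpos := colJac_pos hτ k
    have hφi : Function.Injective φ := by
      rw [← LinearMap.ker_eq_bot]
      by_contra hker
      exact hcpos.ne' (hdet ▸ LinearMap.det_eq_zero_iff_ker_ne_bot.2 hker)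
    have hφc : Continuous φ := LinearMap.continuous_of_finiteDimensional φ
    have hB'm : MeasurableSet (Set.image φ B) := (hBc.image hφc).measurableSet
    have hmem : ∀ u, φ u ∈ Set.image φ B ↔ u ∈ B := fun u => hφi.mem_set_image
    have key := h.lintegral_coords hV1 hV2 hV3 hk hJ hπ hJπ hτ (u₀ := 0)
      (by rw [hτdef, replace_mul_blkProj, map_zero, add_zero]) hφ
      (G := fun p => A.indicator 1 p.1 *
        (ENNReal.ofReal (Real.exp (-p.2.2.trace)) * (Set.image φ B).indicator 1 p.2.1))
      (((measurable_one.indicator hAm).comp measurable_fst).mul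
        (((measurable_ofReal_exp_neg (f := Matrix.trace) (by fun_prop)).comp
          measurable_snd.snd).mul ((measurable_one.indicator hB'm).comp measurable_snd.fst)))
    have h1 : lam (Set.image φ B) = ENNReal.ofReal (colJac V k τ) * lam B := by
      rw [Measure.addHaar_image_linearMap, hdet, abs_of_pos hcpos]
    rw [← lintegral_colMeasure hAm (measurable_one.indicator hB'm), ← hlam,
      lintegral_indicator_one hB'm, h1, ← mul_assoc,
      ← ENNReal.ofReal_mul (chi_pos hτ _).le, hτdef, chi_replace_mul_colJac hT] at key
    rw [mul_comm, ENNReal.ofReal_mul (chi_pos hT _).le, ENNReal.ofReal_toReal hBt, ← key, lapH,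
      lintegral_map (measurable_ofReal_exp_neg (continuous_trace_rhoM T)) (measurable_colY k),
      ← lintegral_indicator hS]
    refine lintegral_congr_ae ?_
    filter_upwards [h.mem, h.supp, h.ae_tdiag_ne_zero hk] with x hx hs hx0
    have hy := colY_mem hV2 hV3 hx hs hx0
    have h2 : τ * colY k x * τᵀ = T * colY k x * Tᵀ := by
      have e1 : τ * colY k x = T * colY k x := lower_mul_eq_of_suppGE hy.2
      have e2 : colY k x * τᵀ = colY k x * Tᵀ := by
        have := congrArg Matrix.transpose e1
        rwa [Matrix.transpose_mul, Matrix.transpose_mul, hy.1.1.1] at this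
      rw [e1, Matrix.mul_assoc, e2, Matrix.mul_assoc]
    simp only [← hτdef, coords, h2, zero_add]
    by_cases hxA : tdiag x k ∈ A
    · rw [Set.indicator_of_mem hxA]
      by_cases hxB : π (colW k x - blkProj k) ∈ B
      · rw [Set.indicator_of_mem ((hmem _).2 hxB),
          Set.indicator_of_mem (show x ∈ S from ⟨hxA, hxB⟩)]
        simp
      · rw [Set.indicator_of_notMem (fun h' => hxB ((hmem _).1 h')),
          Set.indicator_of_notMem (fun h' : x ∈ S => hxB h'.2)]
        simp
    · rw [Set.indicator_of_notMem hxA,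
        Set.indicator_of_notMem (fun h' : x ∈ S => hxA h'.1), zero_mul]

end ColumnReduction

section Necessity

variable {V : ∀ l k : Fin (r + 1), Submodule ℝ (Matrix (Fin (n l)) (Fin (n k)) ℝ)}
  {s : Fin (r + 1) → ℝ}

theorem xiBound_update {ε : Fin (r + 1) → Bool} {k : Fin (r + 1)} (hk : ε k = false)
    (j : Fin (r + 1)) :
    xiBound V (Function.update ε k true) j = xiBound V ε j + 1 / 2 * colDim V k j := by
  have h1 := sum_colDim (V := V) (Function.update ε k true) j
  have h2 := sum_colDim (V := V) ε j
  have h3 : univ.filter (fun i => Function.update ε k true i = true) =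
      insert k (univ.filter fun i => ε i = true) := by
    ext i
    by_cases hi : i = k <;> simp [Function.update_apply, hi]
  rw [h3, Finset.sum_insert (by simp [hk])] at h1
  linarith

theorem exists_isRiesz (hV1 : CondV1 V) (hV2 : CondV2 V) (hV3 : CondV3 V) {μ : Measure (Mat r n)}
    (h : IsRiesz V 0 s 1 μ) (m : ℕ) (hm : m ≤ r + 1) :
    ∃ ε σ C ν, IsRiesz V m σ C ν ∧ (∀ j : Fin (r + 1), m ≤ j.val → ε j = false) ∧
      (∀ j : Fin (r + 1), m ≤ j.val → σ j = s j - xiBound V ε j) ∧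
      ∀ j : Fin (r + 1), j.val < m → (ε j = true → xiBound V ε j < s j) ∧
        (ε j = false → s j = xiBound V ε j) := by
  induction m with
  | zero =>
    refine ⟨fun _ => false, s, 1, μ, h, fun _ _ => rfl, fun j _ => ?_, fun j hj =>
      absurd hj (Nat.not_lt_zero _)⟩
    simp [xiBound]
  | succ m ih =>
    obtain ⟨ε, σ, C, ν, hν, h0, hge, hlt⟩ := ih (Nat.le_of_succ_le hm)
    let k : Fin (r + 1) := ⟨m, hm⟩
    have hσk : σ k = s k - xiBound V ε k := hge k le_rfl
    have hεk : ε k = false := h0 k le_rfl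
    rcases (hν.nonneg k).eq_or_lt with hk | hk
    · refine ⟨ε, σ, C, ν, ⟨hν.mem, ?_, hν.pos, hν.lapH_eq⟩, fun j hj => h0 j (by omega),
        fun j hj => hge j (by omega), fun j hj => ?_⟩
      · filter_upwards [hν.mem, hν.supp, hν.ae_tdiag_eq_zero hk.symm] with x hx hs hx0
        exact suppGE_succ_of_tdiag_eq_zero (k := k) hx hs hx0
      · rcases Nat.lt_succ_iff_lt_or_eq.1 hj with hj | hj
        · exact hlt j hj
        · obtain rfl : j = k := Fin.ext hj
          exact ⟨fun h' => by simp [hεk] at h', fun _ => by linarith⟩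
    · obtain ⟨C', ν', hν'⟩ := IsRiesz.step (k := k) hV1 hV2 hV3 hν hk
      have hne : ∀ j : Fin (r + 1), m + 1 ≤ j.val → j ≠ k := fun j hj h' => by
        have := congrArg Fin.val h'
        simp only [k] at this
        omega
      have hsame : ∀ j : Fin (r + 1), j ≤ k →
          xiBound V (Function.update ε k true) j = xiBound V ε j := fun j hj => by
        rw [xiBound_update hεk, colDim, if_neg hj.not_gt, Nat.cast_zero, mul_zero, add_zero]
      refine ⟨Function.update ε k true, _, C', ν', hν', fun j hj => ?_, fun j hj => ?_,
        fun j hj => ?_⟩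
      · rw [Function.update_of_ne (hne j hj)]
        exact h0 j (by omega)
      · rw [if_neg (hne j hj), xiBound_update hεk, hge j (by omega)]
        ring
      · rw [hsame j (Nat.lt_succ_iff.1 hj)]
        rcases Nat.lt_succ_iff_lt_or_eq.1 hj with hj | hj
        · rw [Function.update_of_ne (fun h' => by subst h'; exact lt_irrefl _ hj)]
          exact hlt j hj
        · obtain rfl : j = k := Fin.ext hj
          rw [Function.update_self]
          exact ⟨fun _ => by linarith, fun h' => by simp at h'⟩

theorem mem_XiSet_of_lapH (hV1 : CondV1 V) (hV2 : CondV2 V) (hV3 : CondV3 V)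
    {μ : Measure (Mat r n)} (hZ : μ (Zspace V)ᶜ = 0)
    (h : ∀ T ∈ Hgrp V, lapH μ T = ENNReal.ofReal (chi (-s) T)) : s ∈ XiSet V := by
  have h0 : IsRiesz V 0 s 1 μ :=
    ⟨measure_compl_psdCone_eq_zero hV1 hV2 hV3 hZ h,
      Filter.Eventually.of_forall fun _ _ _ hp => absurd hp (Nat.not_lt_zero _), one_pos,
      fun T hT => by rw [one_mul, h T hT]⟩
  obtain ⟨ε, -, -, -, -, -, -, hε⟩ := exists_isRiesz hV1 hV2 hV3 h0 (r + 1) le_rfl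
  exact Set.mem_iUnion.2 ⟨ε, fun k => hε k k.2⟩

end Necessity

section DualCone

variable {V : ∀ l k : Fin (r + 1), Submodule ℝ (Matrix (Fin (n l)) (Fin (n k)) ℝ)}
  {rstar : Mat r n → Mat r n → Mat r n}

theorem one_mem_Zspace : (1 : Mat r n) ∈ Zspace V := mem_Zspace_iff.2 one_mem_Zsub

theorem tip_rstar_one (hrstar : ∀ T ∈ Hgrp V, ∀ ξ ∈ Zspace V, rstar T ξ ∈ Zspace V ∧
      ∀ x ∈ Zspace V, tip (rstar T ξ) x = tip ξ (rhoM T x)) {T : Mat r n} (hT : T ∈ Hgrp V)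
    {x : Mat r n} (hx : x ∈ Zspace V) : tip (rstar T 1) x = (T * x * Tᵀ).trace := by
  rw [(hrstar T hT 1 one_mem_Zspace).2 x hx, tip, Matrix.one_mul, rhoM]

theorem rstar_one_mem_Qcone (hV1 : CondV1 V) (hV2 : CondV2 V) (hV3 : CondV3 V)
    (hrstar : ∀ T ∈ Hgrp V, ∀ ξ ∈ Zspace V, rstar T ξ ∈ Zspace V ∧
      ∀ x ∈ Zspace V, tip (rstar T ξ) x = tip ξ (rhoM T x)) {T : Mat r n} (hT : T ∈ Hgrp V) :
    rstar T 1 ∈ Qcone V := by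
  refine ⟨(hrstar T hT 1 one_mem_Zspace).1, fun x hx h0 => ?_⟩
  rw [closure_Pcone] at hx
  rw [tip_rstar_one hrstar hT (mem_Zspace_iff.2 hx.1)]
  exact trace_rhoM_pos hV1 hV2 hV3 hT hx h0

theorem exists_rstar_one_eq (hV1 : CondV1 V) (hV2 : CondV2 V) (hV3 : CondV3 V)
    (hrstar : ∀ T ∈ Hgrp V, ∀ ξ ∈ Zspace V, rstar T ξ ∈ Zspace V ∧
      ∀ x ∈ Zspace V, tip (rstar T ξ) x = tip ξ (rhoM T x)) {ξ : Mat r n} (hξ : ξ ∈ Qcone V) :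
    ∃ T ∈ Hgrp V, rstar T 1 = ξ := by
  obtain ⟨T, hT, h⟩ := exists_Hgrp_of_pos hV1 hV2 hV3
    ((Matrix.traceLinearMap (Idx r n) ℝ ℝ).comp (LinearMap.mulLeft ℝ ξ))
    fun x hx h0 => hξ.2 x (by rwa [closure_Pcone]) h0
  refine ⟨T, hT, sub_eq_zero.1 (trace_mul_transpose_self_eq_zero ?_)⟩
  have hd : rstar T 1 - ξ ∈ Zsub V := Submodule.sub_mem _
    (mem_Zspace_iff.1 (hrstar T hT 1 one_mem_Zspace).1) (mem_Zspace_iff.1 hξ.1)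
  have h1 := tip_rstar_one hrstar hT (mem_Zspace_iff.2 hd)
  have h2 : (ξ * (rstar T 1 - ξ)).trace = _ := h _ hd
  rw [hd.1]
  nth_rewrite 1 [Matrix.sub_mul]
  rw [Matrix.trace_sub, h2, ← h1, tip, sub_self]

theorem laplace_rstar_one (hrstar : ∀ T ∈ Hgrp V, ∀ ξ ∈ Zspace V, rstar T ξ ∈ Zspace V ∧
      ∀ x ∈ Zspace V, tip (rstar T ξ) x = tip ξ (rhoM T x)) {T : Mat r n} (hT : T ∈ Hgrp V)
    {μ : Measure (Mat r n)} (hZ : μ (Zspace V)ᶜ = 0) : laplace μ (rstar T 1) = lapH μ T := by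
  refine lintegral_congr_ae ?_
  filter_upwards [measure_eq_zero_iff_ae_notMem.1 hZ] with x hx
  rw [tip_rstar_one hrstar hT (not_not.1 hx)]

end DualCone

end Development

/-- There exists a positive measure `R_s` on `𝒵` whose Laplace transform
satisfies `L_{R_s}(ξ) = δ_{-s}(ξ)` for all `ξ ∈ 𝒬` if and only if `s ∈ Ξ` (the Gindikin
set); moreover, the support of any such measure is contained in the closure of `𝒫`. -/
theorem statement4 (r : ℕ) (n : Fin (r + 1) → ℕ+)
    (V : ∀ l k : Fin (r + 1), Submodule ℝ (Matrix (Fin (n l)) (Fin (n k)) ℝ))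
    (hV1 : CondV1 V) (hV2 : CondV2 V) (hV3 : CondV3 V)
    (rstar : Mat r n → Mat r n → Mat r n)
    (hrstar : ∀ T ∈ Hgrp V, ∀ ξ ∈ Zspace V, rstar T ξ ∈ Zspace V ∧
      ∀ x ∈ Zspace V, tip (rstar T ξ) x = tip ξ (rhoM T x))
    (δf : (Fin (r + 1) → ℝ) → Mat r n → ℝ)
    (hδ : ∀ s : Fin (r + 1) → ℝ, ∀ T ∈ Hgrp V, δf s (rstar T 1) = chi s T) :
    ∀ s : Fin (r + 1) → ℝ,
      ((∃ μ : Measure (Mat r n), μ (Zspace V)ᶜ = 0 ∧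
          ∀ ξ ∈ Qcone V, laplace μ ξ = ENNReal.ofReal (δf (-s) ξ)) ↔ s ∈ XiSet V) ∧
      (∀ μ : Measure (Mat r n), μ (Zspace V)ᶜ = 0 →
        (∀ ξ ∈ Qcone V, laplace μ ξ = ENNReal.ofReal (δf (-s) ξ)) →
        μ (closure (Pcone V))ᶜ = 0) := by
  have hiff : ∀ (s : Fin (r + 1) → ℝ) (μ : Measure (Mat r n)), μ (Zspace V)ᶜ = 0 →
      ((∀ ξ ∈ Qcone V, laplace μ ξ = ENNReal.ofReal (δf (-s) ξ)) ↔
        ∀ T ∈ Hgrp V, lapH μ T = ENNReal.ofReal (chi (-s) T)) := by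
    intro s μ hZ
    constructor
    · intro h T hT
      rw [← laplace_rstar_one hrstar hT hZ, h _ (rstar_one_mem_Qcone hV1 hV2 hV3 hrstar hT),
        hδ _ T hT]
    · intro h ξ hξ
      obtain ⟨T, hT, rfl⟩ := exists_rstar_one_eq hV1 hV2 hV3 hrstar hξ
      rw [laplace_rstar_one hrstar hT hZ, h T hT, hδ _ T hT]
  refine fun s => ⟨⟨?_, fun hs => ?_⟩, fun μ hZ h => ?_⟩
  · rintro ⟨μ, hZ, h⟩
    exact mem_XiSet_of_lapH hV1 hV2 hV3 hZ ((hiff s μ hZ).1 h)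
  · obtain ⟨μ, hμ, h⟩ := exists_measure_of_mem_XiSet hV1 hV2 hV3 hs
    have hZ : μ (Zspace V)ᶜ = 0 := measure_mono_null
      (Set.compl_subset_compl.2 fun x hx => mem_Zspace_iff.2 hx.1) hμ
    exact ⟨μ, hZ, (hiff s μ hZ).2 h⟩
  · rw [closure_Pcone]
    exact measure_compl_psdCone_eq_zero hV1 hV2 hV3 hZ ((hiff s μ hZ).1 h)

end Wishart
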